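/- arXiv:2305.02864 — 3 statements merged into one kernel-verified Lean document; each statement's English description precedes it below -/
import Mathlib

section
/- Let n ≥ 2 and K ∈ 𝒦ⁿ a convex body with section volume CDF G_K. Then there exists a sequence (K_m)_{m∈ℕ} of strictly convex bodies in 𝒦ⁿ such that the corresponding section volume CDFs G_{K_m} converge pointwise to G_K as m → ∞, i.e. for every z ∈ ℝ, lim_{m→∞} G_{K_m}(z) = G_K(z). -/
open MeasureTheory Set Pointwise
open scoped RealInnerProductSpace NNReal ENNReal

noncomputable section

abbrev Euc (n : ℕ) := EuclideanSpace ℝ (Fin n)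

/-- The unit sphere `S^{n-1}` in `ℝⁿ`. -/
def unitSphere (n : ℕ) : Set (Euc n) := {θ | ‖θ‖ = 1}

/-- The upper hemisphere `S₊^{n-1}`: unit vectors whose last coordinate is nonnegative. -/
def upperHemi (n : ℕ) : Set (Euc n) :=
  {θ | ‖θ‖ = 1 ∧ ∀ i : Fin n, (i : ℕ) = n - 1 → 0 ≤ θ i}

/-- The hyperplane `T_{θ,s} = {x : ⟨x,θ⟩ = s}`. -/
def hyperplane {n : ℕ} (θ : Euc n) (s : ℝ) : Set (Euc n) := {x | ⟪x, θ⟫ = s}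

/-- Spherical Lebesgue measure, realized as the `(n-1)`-dimensional Hausdorff measure. -/
def sphMeasure (n : ℕ) : Measure (Euc n) := μH[(n : ℝ) - 1]

/-- `vol_{n-1}(K ∩ T_{θ,s})`. -/
def sectionVolume {n : ℕ} (K : Set (Euc n)) (θ : Euc n) (s : ℝ) : ℝ :=
  (μH[(n : ℝ) - 1] (K ∩ hyperplane θ s)).toReal

/-- `μ([K])`. -/
def muBracket {n : ℕ} (K : Set (Euc n)) : ℝ :=
  ∫ θ in upperHemi n,
    (∫ s : ℝ, Set.indicator {s : ℝ | (K ∩ hyperplane θ s).Nonempty} (fun _ => (1 : ℝ)) s)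
    ∂ sphMeasure n

/-- The section volume CDF `G_K`. -/
def sectionCDF {n : ℕ} (K : Set (Euc n)) (z : ℝ) : ℝ :=
  (1 / muBracket K) *
    ∫ θ in upperHemi n,
      (∫ s : ℝ, Set.indicator
          {s : ℝ | sectionVolume K θ s ≤ z ∧ (K ∩ hyperplane θ s).Nonempty}
          (fun _ => (1 : ℝ)) s)
      ∂ sphMeasure n

/-- A convex body: a compact convex set with nonempty interior. -/
structure IsConvexBody {n : ℕ} (K : Set (Euc n)) : Prop where
  convex : Convex ℝ K
  isCompact : IsCompact K
  interiorNonempty : (interior K).Nonempty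


/-- `f_θ(s) = vol_{n-1}(K ∩ T_{θ,s})^{1/(n-1)}`. -/
def fTheta {n : ℕ} (K : Set (Euc n)) (θ : Euc n) (s : ℝ) : ℝ :=
  sectionVolume K θ s ^ ((1 : ℝ) / ((n : ℝ) - 1))

/-- The inner section function `m_K(θ) = max_s vol_{n-1}(K ∩ T_{θ,s})`. -/
def innerSection {n : ℕ} (K : Set (Euc n)) (θ : Euc n) : ℝ :=
  ⨆ s : ℝ, sectionVolume K θ s

/-- A CDF `G` is absolutely continuous w.r.t. Lebesgue measure if it admits a Lebesgue
density, i.e. `G z = ∫_{-∞}^z g(t) dt` for some nonnegative `g`. -/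
def IsAbsolutelyContinuousCDF (G : ℝ → ℝ) : Prop :=
  ∃ g : ℝ → ℝ, (∀ t, 0 ≤ g t) ∧ ∀ z : ℝ, G z = ∫ t in Set.Iic z, g t

/-- The width of `K` in direction `θ`: the length of the orthogonal projection of `K` on the
line through the origin with direction `θ`. -/
def width {n : ℕ} (K : Set (Euc n)) (θ : Euc n) : ℝ :=
  sSup ((fun x => ⟪x, θ⟫) '' K) - sInf ((fun x => ⟪x, θ⟫) '' K)

/-- The mean width `b̄(K)`. -/
def meanWidth {n : ℕ} (K : Set (Euc n)) : ℝ :=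
  (1 / (sphMeasure n (upperHemi n)).toReal) * ∫ θ in upperHemi n, width K θ ∂ sphMeasure n

/-- A strictly convex body: a convex body such that every proper convex combination of two
distinct points of `K` lies in the interior of `K`. -/
def IsStrictlyConvexBody {n : ℕ} (K : Set (Euc n)) : Prop :=
  IsConvexBody K ∧ ∀ x ∈ K, ∀ y ∈ K, x ≠ y →
    ∀ l : ℝ, l ∈ Set.Ioo (0 : ℝ) 1 → l • x + (1 - l) • y ∈ interior K

/-- A full-dimensional convex polytope: the convex hull of finitely many points, with
nonempty interior. -/
def IsFullDimPolytope {n : ℕ} (P : Set (Euc n)) : Prop :=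
  (∃ V : Finset (Euc n), P = convexHull ℝ (V : Set (Euc n))) ∧ (interior P).Nonempty

lemma exists_gaugeFn {n : ℕ} (K : Set (Euc n)) (hK : IsConvexBody K) :
    ∃ (f : Euc n → ℝ) (x0 : Euc n), Continuous f ∧ ConvexOn ℝ univ f ∧ (∀ x, f x ≤ 1 ↔ x ∈ K) ∧
      (∀ x ∈ interior K, f x < 1) ∧ f x0 = 0 := by
  obtain ⟨x0, hx0⟩ := hK.interiorNonempty
  set S : Set (Euc n) := (fun y => y + x0) ⁻¹' K with hS
  have hSc : Convex ℝ S := hK.convex.translate_preimage_left x0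
  have hcont : Continuous (fun y : Euc n => y + x0) := by fun_prop
  have hS0 : S ∈ nhds 0 := by
    apply hcont.continuousAt.preimage_mem_nhds
    simpa using mem_interior_iff_mem_nhds.1 hx0
  have hScl : IsClosed S := hK.isCompact.isClosed.preimage hcont
  have habs := absorbent_nhds_zero (𝕜 := ℝ) hS0
  refine ⟨fun x => gauge S (x - x0), x0, ?_, ?_, ?_, ?_, ?_⟩
  · exact (continuous_gauge hSc hS0).comp (by fun_prop)
  · refine ⟨convex_univ, ?_⟩
    intro x _ y _ a b ha hb hab
    have : a • x + b • y - x0 = a • (x - x0) + b • (y - x0) := by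
      have : x0 = (a + b) • x0 := by rw [hab, one_smul]
      nth_rw 1 [this]
      module
    simp only [this]
    refine (gauge_add_le hSc habs _ _).trans ?_
    rw [gauge_smul_of_nonneg ha, gauge_smul_of_nonneg hb]
  · intro x
    rw [gauge_le_one_iff_mem_closure hSc hS0, hScl.closure_eq]
    simp [hS]
  · intro x hx
    rw [gauge_lt_one_iff_mem_interior hSc hS0]
    rw [mem_interior_iff_mem_nhds] at hx ⊢
    apply hcont.continuousAt.preimage_mem_nhds
    simpa using hx
  · simp

lemma exists_approx {n : ℕ} (K : Set (Euc n)) (hK : IsConvexBody K) :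
    ∃ Km : ℕ → Set (Euc n), (∀ m, IsStrictlyConvexBody (Km m)) ∧ (∀ m, Km m ⊆ K) ∧
      ∀ C, IsCompact C → C ⊆ interior K → ∀ᶠ m in Filter.atTop, C ⊆ Km m := by
  obtain ⟨f, x0, hfc, hfconv, hfK, hfint, hf0⟩ := exists_gaugeFn K hK
  have hnorm : ∀ x y : Euc n, x ≠ y → ∀ l : ℝ, l ∈ Ioo (0 : ℝ) 1 →
      ‖l • x + (1 - l) • y - x0‖ ^ 2 < l * ‖x - x0‖ ^ 2 + (1 - l) * ‖y - x0‖ ^ 2 := by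
    intro x y hxy l hl
    have h1 : l • x + (1 - l) • y - x0 = l • (x - x0) + (1 - l) • (y - x0) := by module
    have h2 : 0 < ‖(x - x0) - (y - x0)‖ ^ 2 := by
      have : (x - x0) - (y - x0) ≠ 0 := by simpa [sub_eq_zero] using hxy
      positivity
    rw [h1]
    generalize x - x0 = u at *
    generalize y - x0 = v at *
    rw [norm_sub_sq_real] at h2
    rw [norm_add_sq_real, norm_smul, norm_smul, real_inner_smul_left, real_inner_smul_right,
      Real.norm_of_nonneg hl.1.le, Real.norm_of_nonneg (by linarith [hl.2])]
    nlinarith [mul_pos (mul_pos hl.1 (sub_pos.2 hl.2)) h2]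
  let F : ℕ → Euc n → ℝ := fun m x => f x + (1 / ((m : ℝ) + 1)) * ‖x - x0‖ ^ 2
  have hFc : ∀ m, Continuous (F m) := fun m => by
    dsimp only [F]; fun_prop
  have hε : ∀ m : ℕ, 0 < 1 / ((m : ℝ) + 1) := fun m => by positivity
  have hsub : ∀ m, {x | F m x ≤ 1} ⊆ K := by
    intro m x hx
    rw [← hfK]
    have : 0 ≤ (1 / ((m : ℝ) + 1)) * ‖x - x0‖ ^ 2 := by positivity
    simp only [F, mem_ofPred_eq] at hx
    linarith
  have hint : ∀ m x, F m x < 1 → x ∈ interior {x | F m x ≤ 1} := by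
    intro m x hx
    exact interior_maximal (fun y hy => le_of_lt hy) (isOpen_lt (hFc m) continuous_const) hx
  have hstrict : ∀ m, ∀ x ∈ {x | F m x ≤ 1}, ∀ y ∈ {x | F m x ≤ 1}, x ≠ y →
      ∀ l : ℝ, l ∈ Set.Ioo (0 : ℝ) 1 → F m (l • x + (1 - l) • y) < 1 := by
    intro m x hx y hy hxy l hl
    have h1 := hfconv.2 (mem_univ x) (mem_univ y) hl.1.le (sub_pos.2 hl.2).le (by ring)
    have h2 := mul_lt_mul_of_pos_left (hnorm x y hxy l hl) (hε m)
    simp only [F, mem_ofPred_eq, smul_eq_mul] at *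
    nlinarith [mul_le_mul_of_nonneg_left hx hl.1.le,
      mul_le_mul_of_nonneg_left hy (sub_pos.2 hl.2).le]
  refine ⟨fun m => {x | F m x ≤ 1}, fun m => ⟨⟨?_, ?_, ?_⟩, ?_⟩, hsub, ?_⟩
  · rw [convex_iff_forall_pos]
    intro x hx y hy a b ha hb hab
    by_cases hxy : x = y
    · subst hxy
      rw [← add_smul, hab, one_smul]; exact hx
    · obtain rfl : b = 1 - a := by linarith
      exact (hstrict m x hx y hy hxy a ⟨ha, by linarith⟩).le
  · exact hK.isCompact.of_isClosed_subset (isClosed_le (hFc m) continuous_const) (hsub m)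
  · exact ⟨x0, hint m x0 (by simp [F, hf0])⟩
  · intro x hx y hy hxy l hl
    exact hint m _ (hstrict m x hx y hy hxy l hl)
  · intro C hC hCK
    rcases C.eq_empty_or_nonempty with rfl | hne
    · simp
    obtain ⟨c, hcC, hc⟩ := hC.exists_isMaxOn hne hfc.continuousOn
    obtain ⟨d, hdC, hd⟩ := hC.exists_isMaxOn hne
      (f := fun x => ‖x - x0‖ ^ 2) (by fun_prop)
    have hlim : Filter.Tendsto (fun m : ℕ => f c + (1 / ((m : ℝ) + 1)) * ‖d - x0‖ ^ 2)
        Filter.atTop (nhds (f c + 0 * ‖d - x0‖ ^ 2)) :=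
      (tendsto_one_div_add_atTop_nhds_zero_nat.mul_const _).const_add _
    have := hlim.eventually_lt_const (u := 1) (by simpa using hfint c (hCK hcC))
    filter_upwards [this] with m hm x hx
    have h1 : f x ≤ f c := hc hx
    have h2 : ‖x - x0‖ ^ 2 ≤ ‖d - x0‖ ^ 2 := hd hx
    have h3 := mul_le_mul_of_nonneg_left h2 (hε m).le
    simp only [F, mem_ofPred_eq]
    linarith

lemma exists_param {n : ℕ} (hn : 2 ≤ n) :
    ∃ (E : Submodule ℝ (Euc n)) (g : Euc n × ℝ → E → Euc n),
      Module.finrank ℝ E = n - 1 ∧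
      Measurable (fun p : (Euc n × ℝ) × E => g p.1 p.2) ∧
      ∀ p : Euc n × ℝ, ‖p.1‖ = 1 → Isometry (g p) ∧ range (g p) = hyperplane p.1 p.2 := by
  let e : Euc n := EuclideanSpace.single ⟨0, by omega⟩ 1
  have he : ‖e‖ = 1 := by simp [e]
  have he0 : e ≠ 0 := by intro h; simp [h] at he
  let R : Euc n → (Euc n ≃ₗᵢ[ℝ] Euc n) := fun θ => Submodule.reflection (Submodule.span ℝ {e - θ})ᗮ
  refine ⟨(Submodule.span ℝ {e})ᗮ, fun p x => R p.1 x + p.2 • p.1, ?_, ?_, ?_⟩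
  · have : Fact (Module.finrank ℝ (Euc n) = (n - 1) + 1) := ⟨by simp; omega⟩
    exact Submodule.finrank_orthogonal_span_singleton he0
  · have : ∀ θ x : Euc n, R θ x =
        -(2 • (⟪e - θ, x⟫ / (‖e - θ‖ ^ 2)) • (e - θ) - x) := by
      intro θ x
      simp only [R]
      rw [Submodule.reflection_orthogonal_apply, Submodule.reflection_singleton_apply]
      simp
    simp only [this]
    fun_prop
  · rintro ⟨θ, s⟩ hθ
    simp only at hθ
    have hR : R θ e = θ := Submodule.reflection_sub (by rw [he, hθ])
    constructor
    · intro x y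
      simp only [edist_add_right]
      rw [(R θ).isometry.edist_eq]; rfl
    · ext y
      simp only [mem_range, hyperplane, mem_ofPred_eq]
      have key : ∀ x : Euc n, ⟪R θ x, θ⟫ = ⟪x, e⟫ := by
        intro x
        have := (R θ).inner_map_map x e
        rwa [hR] at this
      constructor
      · rintro ⟨x, rfl⟩
        have hx := Submodule.mem_orthogonal_singleton_iff_inner_left.1 x.2
        rw [inner_add_left, real_inner_smul_left, real_inner_self_eq_norm_sq, hθ]
        have := key x
        simp [this, hx]
      · intro hy
        refine ⟨⟨(R θ).symm (y - s • θ), ?_⟩, by simp⟩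
        rw [Submodule.mem_orthogonal_singleton_iff_inner_left, ← key]
        simp [inner_sub_left, real_inner_smul_left, hy, hθ]

lemma section_facts {n : ℕ} (hn : 2 ≤ n) {K : Set (Euc n)} (hK : IsCompact K) :
    ∃ V : Euc n × ℝ → ℝ≥0∞, Measurable V ∧
      ∀ p : Euc n × ℝ, ‖p.1‖ = 1 → μH[(n : ℝ) - 1] (K ∩ hyperplane p.1 p.2) = V p ∧ V p < ∞ := by
  obtain ⟨E, g, hE, hg, hp⟩ := exists_param hn
  have hdim : (n : ℝ) - 1 = (Module.finrank ℝ E : ℝ) := by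
    rw [hE]; push_cast [show 1 ≤ n by omega]; ring
  rw [hdim]
  refine ⟨fun p => μH[(Module.finrank ℝ E : ℝ)] (g p ⁻¹' K), ?_, ?_⟩
  · exact measurable_measure_prodMk_left (hg hK.measurableSet)
  · intro p hp1
    obtain ⟨hiso, hr⟩ := hp p hp1
    constructor
    · rw [← hr, ← image_preimage_eq_inter_range, hiso.hausdorffMeasure_image (Or.inl (by positivity))]
    · exact (hiso.isClosedEmbedding.isCompact_preimage hK).measure_lt_top

lemma section_finite {n : ℕ} (hn : 2 ≤ n) {K : Set (Euc n)} (hK : IsCompact K) {θ : Euc n}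
    (hθ : ‖θ‖ = 1) (s : ℝ) : μH[(n : ℝ) - 1] (K ∩ hyperplane θ s) < ∞ := by
  obtain ⟨V, -, h⟩ := section_facts hn hK
  obtain ⟨h1, h2⟩ := h (θ, s) hθ
  simp only at h1
  rwa [h1]

lemma meas_hit {n : ℕ} {K : Set (Euc n)} (hK : IsCompact K) :
    MeasurableSet {p : Euc n × ℝ | (K ∩ hyperplane p.1 p.2).Nonempty} := by
  have : CompactSpace K := isCompact_iff_compactSpace.1 hK
  have h1 : IsClosed {q : K × (Euc n × ℝ) | ⟪(q.1 : Euc n), q.2.1⟫ = q.2.2} :=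
    isClosed_eq (by fun_prop) (by fun_prop)
  have h2 := isClosedMap_snd_of_compactSpace _ h1
  convert h2.measurableSet using 1
  ext p
  constructor
  · rintro ⟨x, hx, hx'⟩
    exact ⟨(⟨x, hx⟩, p), hx', rfl⟩
  · rintro ⟨⟨x, q⟩, hx', rfl⟩
    exact ⟨x, x.2, hx'⟩

lemma meas_cdf {n : ℕ} (hn : 2 ≤ n) {K : Set (Euc n)} (hK : IsCompact K) (z : ℝ) :
    MeasurableSet {p : Euc n × ℝ | ‖p.1‖ = 1 ∧ sectionVolume K p.1 p.2 ≤ z ∧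
      (K ∩ hyperplane p.1 p.2).Nonempty} := by
  obtain ⟨V, hV, h⟩ := section_facts hn hK
  have : {p : Euc n × ℝ | ‖p.1‖ = 1 ∧ sectionVolume K p.1 p.2 ≤ z ∧
      (K ∩ hyperplane p.1 p.2).Nonempty} = {p | ‖p.1‖ = 1} ∩ ({p | (V p).toReal ≤ z} ∩
        {p | (K ∩ hyperplane p.1 p.2).Nonempty}) := by
    ext p
    simp only [mem_ofPred_eq, mem_inter_iff]
    refine and_congr_right fun hp => ?_
    rw [sectionVolume, (h p hp).1]
  rw [this]
  exact (measurableSet_eq_fun (by fun_prop) measurable_const).inter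
    ((measurableSet_le hV.ennreal_toReal measurable_const).inter (meas_hit hK))

lemma conv_lemma {n : ℕ} (μ : Measure (Euc n)) [IsFiniteMeasure μ] (B : ℕ → Euc n → Set ℝ)
    (B' : Euc n → Set ℝ)
    (hB : ∀ m, MeasurableSet {p : Euc n × ℝ | ‖p.1‖ = 1 ∧ p.2 ∈ B m p.1}) (R : ℝ)
    (hμ : ∀ᵐ θ ∂μ, ‖θ‖ = 1)
    (hR : ∀ θ, ‖θ‖ = 1 → ∀ m s, s ∈ B m θ → s ∈ Icc (-R) R)
    (h : ∀ θ, ‖θ‖ = 1 → ∀ᵐ s : ℝ, ∀ᶠ m in Filter.atTop, (s ∈ B m θ ↔ s ∈ B' θ)) :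
    Filter.Tendsto (fun m => ∫ θ, (∫ s : ℝ, indicator (B m θ) (fun _ => (1 : ℝ)) s) ∂μ)
      Filter.atTop (nhds (∫ θ, (∫ s : ℝ, indicator (B' θ) (fun _ => (1 : ℝ)) s) ∂μ)) := by
  have hbd : ∀ θ, ‖θ‖ = 1 → ∀ m s, ‖indicator (B m θ) (fun _ => (1 : ℝ)) s‖ ≤
      indicator (Icc (-R) R) (fun _ => (1 : ℝ)) s := by
    intro θ hθ m s
    by_cases hs : s ∈ B m θ
    · simp [hs, hR θ hθ m s hs]
    · simp only [hs, not_false_eq_true, indicator_of_notMem, norm_zero]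
      exact indicator_nonneg (by simp) _
  have hint : Integrable (indicator (Icc (-R) R) (fun _ => (1 : ℝ))) := by
    rw [integrable_indicator_iff measurableSet_Icc]
    simp
  apply tendsto_integral_of_dominated_convergence
    (fun _ => ∫ s : ℝ, indicator (Icc (-R) R) (fun _ => (1 : ℝ)) s)
  · intro m
    have h1 : StronglyMeasurable (fun θ => ∫ s : ℝ,
        indicator {p : Euc n × ℝ | ‖p.1‖ = 1 ∧ p.2 ∈ B m p.1} (fun _ => (1 : ℝ)) (θ, s)) :=
      (stronglyMeasurable_const.indicator (hB m)).integral_prod_right'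
    refine h1.aestronglyMeasurable.congr ?_
    filter_upwards [hμ] with θ hθ
    congr 1
    ext s
    by_cases hs : s ∈ B m θ
    · rw [indicator_of_mem hs, indicator_of_mem (show (θ, s) ∈
        {p : Euc n × ℝ | ‖p.1‖ = 1 ∧ p.2 ∈ B m p.1} from ⟨hθ, hs⟩)]
    · rw [indicator_of_notMem hs, indicator_of_notMem (fun h => hs h.2)]
  · exact integrable_const _
  · intro m
    filter_upwards [hμ] with θ hθ
    exact norm_integral_le_of_norm_le hint (Filter.Eventually.of_forall (hbd θ hθ m))
  · filter_upwards [hμ] with θ hθ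
    apply tendsto_integral_of_dominated_convergence
      (indicator (Icc (-R) R) (fun _ => (1 : ℝ)))
    · intro m
      have : MeasurableSet (B m θ) := by
        have := measurable_prodMk_left (x := θ) (hB m)
        simpa [preimage, hθ] using this
      exact (stronglyMeasurable_const.indicator this).aestronglyMeasurable
    · exact hint
    · intro m
      exact Filter.Eventually.of_forall (hbd θ hθ m)
    · filter_upwards [h θ hθ] with s hs
      apply tendsto_const_nhds.congr'
      filter_upwards [hs] with m hm
      by_cases hs : s ∈ B m θ
      · rw [indicator_of_mem hs, indicator_of_mem (hm.1 hs)]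
      · rw [indicator_of_notMem hs, indicator_of_notMem (fun h => hs (hm.2 h))]

lemma ae_hit {n : ℕ} {K : Set (Euc n)} (hK : IsConvexBody K) (θ : Euc n) :
    ∀ᵐ s : ℝ, (K ∩ hyperplane θ s).Nonempty → (interior K ∩ hyperplane θ s).Nonempty := by
  let L : Euc n →ₗ[ℝ] ℝ := (innerSL ℝ θ).toLinearMap
  have hL : ∀ x, L x = ⟪x, θ⟫ := fun x => by
    simp only [L, ContinuousLinearMap.coe_coe, innerSL_apply_apply]
    exact real_inner_comm _ _
  have hLc : Continuous L := (innerSL ℝ θ).continuous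
  have hconv : Convex ℝ (L '' interior K) := hK.convex.interior.linear_image L
  have h0 := hconv.addHaar_frontier volume
  rw [← compl_mem_ae_iff] at h0
  filter_upwards [h0] with s hs
  rintro ⟨x, hxK, hx⟩
  have h1 : s ∈ closure (L '' interior K) := by
    have hxc : x ∈ closure (interior K) := by
      rw [hK.convex.closure_interior_eq_closure_of_nonempty_interior hK.interiorNonempty]
      exact subset_closure hxK
    have := image_closure_subset_closure_image hLc (mem_image_of_mem L hxc)
    rwa [hL, show ⟪x, θ⟫ = s from hx] at this
  have h2 : s ∈ interior (L '' interior K) := by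
    by_contra h
    exact hs ⟨h1, h⟩
  obtain ⟨y, hy, hys⟩ := interior_subset h2
  exact ⟨y, hy, by rw [← hys, hL]; rfl⟩

lemma section_lower {n : ℕ} (hn : 2 ≤ n) {K : Set (Euc n)} (hK : IsConvexBody K)
    {Km : ℕ → Set (Euc n)} (hc : ∀ m, IsCompact (Km m))
    (hex : ∀ C, IsCompact C → C ⊆ interior K → ∀ᶠ m in Filter.atTop, C ⊆ Km m)
    {θ : Euc n} (hθ : ‖θ‖ = 1) {s : ℝ} (hs : (interior K ∩ hyperplane θ s).Nonempty) {z : ℝ}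
    (hz : z < sectionVolume K θ s) :
    ∀ᶠ m in Filter.atTop, z < sectionVolume (Km m) θ s := by
  obtain ⟨p, hpK, hp⟩ := hs
  have hd : (0 : ℝ) ≤ (n : ℝ) - 1 := by
    have : (2 : ℝ) ≤ n := by exact_mod_cast hn
    linarith
  -- choose the scaling factor
  obtain ⟨c, hc0, hc1, hcz⟩ : ∃ c : ℝ, 0 < c ∧ c < 1 ∧
      z < c ^ ((n : ℝ) - 1) * sectionVolume K θ s := by
    have hcont : ContinuousAt (fun c : ℝ => c ^ ((n : ℝ) - 1) * sectionVolume K θ s) 1 :=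
      (Real.continuousAt_rpow_const 1 _ (Or.inl one_ne_zero)).mul continuousAt_const
    have h1 : ∀ᶠ c in nhds (1 : ℝ), z < c ^ ((n : ℝ) - 1) * sectionVolume K θ s :=
      hcont.eventually_const_lt (by simpa using hz)
    have h2 : ∀ᶠ c in nhdsWithin (1 : ℝ) (Iio 1), c ∈ Ioo (0 : ℝ) 1 :=
      Ioo_mem_nhdsLT one_pos
    obtain ⟨c, h3, h4⟩ := ((h1.filter_mono nhdsWithin_le_nhds).and h2).exists
    exact ⟨c, h4.1, h4.2, h3⟩
  let H := AffineMap.homothety p c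
  have hH : ∀ x, H x = (1 - c) • p + c • x := by
    intro x
    simp only [H, AffineMap.homothety_apply, vsub_eq_sub, vadd_eq_add]
    module
  have hHc : Continuous H := by
    have : (H : Euc n → Euc n) = fun x => (1 - c) • p + c • x := funext hH
    rw [this]; fun_prop
  have hev := hex (H '' K) (hK.isCompact.image hHc) (by
    rintro _ ⟨x, hx, rfl⟩
    rw [hH]
    exact hK.convex.combo_interior_self_mem_interior hpK hx (by linarith) hc0.le (by ring))
  filter_upwards [hev] with m hm
  have hsub : H '' (K ∩ hyperplane θ s) ⊆ Km m ∩ hyperplane θ s := by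
    rintro _ ⟨x, ⟨hxK, hx⟩, rfl⟩
    refine ⟨hm ⟨x, hxK, rfl⟩, ?_⟩
    have hx' : ⟪x, θ⟫ = s := hx
    have hp' : ⟪p, θ⟫ = s := hp
    change ⟪H x, θ⟫ = s
    rw [hH, inner_add_left, real_inner_smul_left, real_inner_smul_left, hx', hp']
    ring
  have h1 := measure_mono (μ := μH[(n : ℝ) - 1]) hsub
  have h2 : μH[(n : ℝ) - 1] (H '' (K ∩ hyperplane θ s)) = _ :=
    hausdorffMeasure_homothety_image hd p hc0.ne' _
  rw [h2] at h1
  have h3 := ENNReal.toReal_mono (section_finite hn (hc m) hθ s).ne h1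
  refine hcz.trans_le (le_trans (le_of_eq ?_) h3)
  rw [ENNReal.toReal_smul]
  simp [sectionVolume, NNReal.smul_def, abs_of_pos hc0]

lemma ev_hit {n : ℕ} {K : Set (Euc n)} {Km : ℕ → Set (Euc n)}
    (hex : ∀ C, IsCompact C → C ⊆ interior K → ∀ᶠ m in Filter.atTop, C ⊆ Km m)
    {θ : Euc n} {s : ℝ} (hs : (interior K ∩ hyperplane θ s).Nonempty) :
    ∀ᶠ m in Filter.atTop, (Km m ∩ hyperplane θ s).Nonempty := by
  obtain ⟨p, hpK, hp⟩ := hs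
  filter_upwards [hex {p} isCompact_singleton (by simpa using hpK)] with m hm
  exact ⟨p, hm rfl, hp⟩

lemma width_lower {n : ℕ} {K : Set (Euc n)} (hK : IsConvexBody K) :
    ∃ r : ℝ, 0 < r ∧ ∀ θ : Euc n, ‖θ‖ = 1 →
      r ≤ ∫ s : ℝ, Set.indicator {s : ℝ | (K ∩ hyperplane θ s).Nonempty} (fun _ => (1 : ℝ)) s := by
  obtain ⟨x0, hx0⟩ := hK.interiorNonempty
  obtain ⟨r, hr, hball⟩ := Metric.nhds_basis_closedBall.mem_iff.1 (mem_interior_iff_mem_nhds.1 hx0)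
  obtain ⟨R, hR⟩ := hK.isCompact.isBounded.exists_norm_le
  refine ⟨r, hr, fun θ hθ => ?_⟩
  have hm : MeasurableSet {s : ℝ | (K ∩ hyperplane θ s).Nonempty} :=
    measurable_prodMk_left (x := θ) (meas_hit hK.isCompact)
  have hsub : Icc ⟪x0, θ⟫ (⟪x0, θ⟫ + r) ⊆ {s : ℝ | (K ∩ hyperplane θ s).Nonempty} := by
    intro s hs
    refine ⟨x0 + (s - ⟪x0, θ⟫) • θ, hball ?_, ?_⟩
    · simp only [Metric.mem_closedBall, dist_self_add_left, norm_smul, hθ, mul_one,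
        Real.norm_eq_abs]
      rw [abs_le]
      constructor <;> linarith [hs.1, hs.2]
    · change ⟪x0 + (s - ⟪x0, θ⟫) • θ, θ⟫ = s
      rw [inner_add_left, real_inner_smul_left, real_inner_self_eq_norm_sq, hθ]
      ring
  have hsup : {s : ℝ | (K ∩ hyperplane θ s).Nonempty} ⊆ Icc (-R) R := by
    rintro s ⟨x, hx, hxs⟩
    have h1 := abs_real_inner_le_norm x θ
    rw [show ⟪x, θ⟫ = s from hxs, hθ, mul_one] at h1
    exact abs_le.1 (h1.trans (hR x hx))
  rw [integral_indicator_const _ hm, smul_eq_mul, mul_one]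
  have h2 := measureReal_mono (μ := (volume : Measure ℝ)) hsub
    ((measure_mono hsup).trans_lt measure_Icc_lt_top).ne
  simpa [hr.le] using h2

lemma measurableSet_upperHemi (n : ℕ) : MeasurableSet (upperHemi n) := by
  have : upperHemi n = {θ : Euc n | ‖θ‖ = 1} ∩
      ⋂ i : Fin n, ⋂ _ : (i : ℕ) = n - 1, {θ : Euc n | 0 ≤ θ i} := by
    ext θ; simp [upperHemi]
  rw [this]
  refine (measurableSet_eq_fun (by fun_prop) measurable_const).inter ?_
  refine MeasurableSet.iInter fun i => MeasurableSet.iInter fun _ => ?_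
  exact measurableSet_le measurable_const (by fun_prop)

lemma muBracket_zero {n : ℕ} {K : Set (Euc n)} (hK : IsConvexBody K)
    (h : ¬ IsFiniteMeasure ((sphMeasure n).restrict (upperHemi n))) : muBracket K = 0 := by
  obtain ⟨r, hr, hw⟩ := width_lower hK
  apply integral_undef
  intro hint
  apply h
  have h1 : Integrable (fun _ : Euc n => r) ((sphMeasure n).restrict (upperHemi n)) := by
    refine hint.mono' aestronglyMeasurable_const ?_
    filter_upwards [ae_restrict_mem (measurableSet_upperHemi n)] with θ hθ
    rw [Real.norm_of_nonneg hr.le]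
    exact hw θ hθ.1
  exact (integrable_const_iff.1 h1).resolve_left hr.ne'

/-- every section volume CDF is the pointwise limit of section volume CDFs
of strictly convex bodies. -/
theorem sectionCDF_limit_of_strictlyConvex {n : ℕ} (hn : 2 ≤ n)
    (K : Set (Euc n)) (hK : IsConvexBody K) :
    ∃ Km : ℕ → Set (Euc n), (∀ m : ℕ, IsStrictlyConvexBody (Km m)) ∧
      ∀ z : ℝ, Filter.Tendsto (fun m => sectionCDF (Km m) z) Filter.atTop
        (nhds (sectionCDF K z)) := by
  obtain ⟨Km, hsc, hsub, hex⟩ := exists_approx K hK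
  refine ⟨Km, hsc, fun z => ?_⟩
  by_cases hfin : IsFiniteMeasure ((sphMeasure n).restrict (upperHemi n))
  swap
  · simp [sectionCDF, muBracket_zero hK hfin, fun m => muBracket_zero (hsc m).1 hfin]
  obtain ⟨R, hR⟩ := hK.isCompact.isBounded.exists_norm_le
  have hμ : ∀ᵐ θ ∂((sphMeasure n).restrict (upperHemi n)), ‖θ‖ = 1 := by
    filter_upwards [ae_restrict_mem (measurableSet_upperHemi n)] with θ hθ using hθ.1
  have hbd : ∀ θ : Euc n, ‖θ‖ = 1 → ∀ m (s : ℝ), (Km m ∩ hyperplane θ s).Nonempty →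
      s ∈ Icc (-R) R := by
    rintro θ hθ m s ⟨x, hx, hxs⟩
    have h1 := abs_real_inner_le_norm x θ
    rw [show ⟪x, θ⟫ = s from hxs, hθ, mul_one] at h1
    exact abs_le.1 (h1.trans (hR x (hsub m hx)))
  have hmu : Filter.Tendsto (fun m => muBracket (Km m)) Filter.atTop (nhds (muBracket K)) := by
    refine conv_lemma ((sphMeasure n).restrict (upperHemi n))
      (fun m θ => {s : ℝ | (Km m ∩ hyperplane θ s).Nonempty})
      (fun θ => {s : ℝ | (K ∩ hyperplane θ s).Nonempty}) ?_ R hμ hbd ?_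
    · intro m
      exact (measurableSet_eq_fun (f := fun p : Euc n × ℝ => ‖p.1‖) (by fun_prop)
        measurable_const).inter (meas_hit (hsc m).1.isCompact)
    · intro θ hθ
      filter_upwards [ae_hit hK θ] with s hs
      by_cases hsK : (K ∩ hyperplane θ s).Nonempty
      · filter_upwards [ev_hit hex (hs hsK)] with m hm
        exact ⟨fun _ => hsK, fun _ => hm⟩
      · refine Filter.Eventually.of_forall fun m => ⟨fun h => ?_, fun h => absurd h hsK⟩
        exact h.mono (inter_subset_inter_left _ (hsub m))
  have hI : Filter.Tendsto (fun m => ∫ θ in upperHemi n,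
      (∫ s : ℝ, Set.indicator
          {s : ℝ | sectionVolume (Km m) θ s ≤ z ∧ (Km m ∩ hyperplane θ s).Nonempty}
          (fun _ => (1 : ℝ)) s) ∂ sphMeasure n) Filter.atTop (nhds (∫ θ in upperHemi n,
      (∫ s : ℝ, Set.indicator
          {s : ℝ | sectionVolume K θ s ≤ z ∧ (K ∩ hyperplane θ s).Nonempty}
          (fun _ => (1 : ℝ)) s) ∂ sphMeasure n)) := by
    refine conv_lemma ((sphMeasure n).restrict (upperHemi n))
      (fun m θ => {s : ℝ | sectionVolume (Km m) θ s ≤ z ∧ (Km m ∩ hyperplane θ s).Nonempty})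
      (fun θ => {s : ℝ | sectionVolume K θ s ≤ z ∧ (K ∩ hyperplane θ s).Nonempty})
      ?_ R hμ (fun θ hθ m s hs => hbd θ hθ m s hs.2) ?_
    · intro m
      exact meas_cdf hn (hsc m).1.isCompact z
    · intro θ hθ
      filter_upwards [ae_hit hK θ] with s hs
      by_cases hsK : (K ∩ hyperplane θ s).Nonempty
      · by_cases hz : sectionVolume K θ s ≤ z
        · filter_upwards [ev_hit hex (hs hsK)] with m hm
          refine ⟨fun _ => ⟨hz, hsK⟩, fun _ => ⟨le_trans ?_ hz, hm⟩⟩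
          exact ENNReal.toReal_mono (section_finite hn hK.isCompact hθ s).ne
            (measure_mono (inter_subset_inter_left _ (hsub m)))
        · filter_upwards [section_lower hn hK (fun m => (hsc m).1.isCompact) hex hθ (hs hsK)
            (not_le.1 hz)] with m hm
          exact ⟨fun h => absurd h.1 (not_le.2 hm), fun h => absurd h.1 hz⟩
      · refine Filter.Eventually.of_forall fun m => ⟨fun h => ?_, fun h => absurd h.2 hsK⟩
        exact absurd (h.2.mono (inter_subset_inter_left _ (hsub m))) hsK
  by_cases hzero : (sphMeasure n).restrict (upperHemi n) = 0
  · simp [sectionCDF, hzero]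
  have hne : muBracket K ≠ 0 := by
    obtain ⟨r, hr, hw⟩ := width_lower hK
    have hint : Integrable (fun θ => ∫ s : ℝ, Set.indicator
        {s : ℝ | (K ∩ hyperplane θ s).Nonempty} (fun _ => (1 : ℝ)) s)
        ((sphMeasure n).restrict (upperHemi n)) := by
      have h1 : StronglyMeasurable (fun θ => ∫ s : ℝ,
          indicator {p : Euc n × ℝ | (K ∩ hyperplane p.1 p.2).Nonempty}
            (fun _ => (1 : ℝ)) (θ, s)) :=
        (stronglyMeasurable_const.indicator (meas_hit hK.isCompact)).integral_prod_right'
      have hi : Integrable (indicator (Icc (-R) R) (fun _ => (1 : ℝ))) := by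
        rw [integrable_indicator_iff measurableSet_Icc]
        simp
      refine (integrable_const
        (∫ s : ℝ, indicator (Icc (-R) R) (fun _ => (1 : ℝ)) s)).mono' h1.aestronglyMeasurable ?_
      filter_upwards [hμ] with θ hθ
      refine norm_integral_le_of_norm_le hi (Filter.Eventually.of_forall fun s => ?_)
      by_cases hs : (K ∩ hyperplane θ s).Nonempty
      · obtain ⟨x, hx, hxs⟩ := id hs
        have h1 := abs_real_inner_le_norm x θ
        rw [show ⟪x, θ⟫ = s from hxs, hθ, mul_one] at h1
        have h2 : s ∈ Icc (-R) R := abs_le.1 (h1.trans (hR x hx))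
        rw [indicator_of_mem (show s ∈ {s : ℝ | (K ∩ hyperplane θ s).Nonempty} from hs),
          indicator_of_mem h2]
        simp
      · rw [indicator_of_notMem (show s ∉ {s : ℝ | (K ∩ hyperplane θ s).Nonempty} from hs),
          norm_zero]
        exact indicator_nonneg (by simp) _
    have h1 : ∫ _ in upperHemi n, r ∂ sphMeasure n ≤ muBracket K := by
      refine integral_mono_ae (integrable_const r) hint ?_
      filter_upwards [hμ] with θ hθ using hw θ hθ
    rw [integral_const, smul_eq_mul] at h1
    have h2 : 0 < ((sphMeasure n).restrict (upperHemi n)).real univ := by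
      rw [measureReal_def]
      refine ENNReal.toReal_pos ?_ (measure_ne_top _ _)
      simpa using hzero
    exact ((mul_pos h2 hr).trans_le h1).ne'
  exact (tendsto_const_nhds.div hmu hne).mul hI
end
end

section
/- Let n ≥ 2 and let P ⊂ ℝⁿ be a full-dimensional convex polytope. Fix θ ∈ S₊^{n-1} and define f_θ(s) = vol_{n-1}(P ∩ T_{θ,s})^{1/(n-1)}. Suppose f_θ attains its maximum on the entire interval [s₋, s₊] with s₋ < s₊. Then there exists x ∈ ℝⁿ such that for every s ∈ [s₋, s₊], P ∩ T_{θ,s} = (P ∩ T_{θ,s₋}) + ((s − s₋)/(s₊ − s₋)) x; that is, all sections P ∩ T_{θ,s} for s ∈ [s₋, s₊] are translates of one another, translated along a common direction. -/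
open MeasureTheory Set Pointwise
open scoped RealInnerProductSpace NNReal ENNReal

noncomputable section

lemma quantile (a : ℝ → ℝ) (a0 a1 : ℝ) (h : a0 < a1) (hc : ContinuousOn a (Ioo a0 a1))
    (hp : ∀ t ∈ Ioo a0 a1, 0 < a t) (hi : IntegrableOn a (Ioo a0 a1)) (α : ℝ)
    (hα : α = ∫ t in Ioo a0 a1, a t) :
    0 < α ∧ ∃ φ : ℝ → ℝ, (∀ s ∈ Ioo (0:ℝ) 1, φ s ∈ Ioo a0 a1 ∧ HasDerivAt φ (α / a (φ s)) s) ∧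
      ∀ t ∈ Ioo a0 a1, ∃ s ∈ Ioo (0:ℝ) 1, φ s = t := by
  have hii : IntervalIntegrable a volume a0 a1 := by
    rw [intervalIntegrable_iff_integrableOn_Ioo_of_le h.le]; exact hi
  set F : ℝ → ℝ := fun t => ∫ x in a0..t, a x with hF
  have hF1 : F a1 = α := by
    rw [hα, ← integral_Ioc_eq_integral_Ioo, ← intervalIntegral.integral_of_le h.le]
  have hF0 : F a0 = 0 := by simp [hF]
  have hFc : ContinuousOn F (Icc a0 a1) := by
    have := intervalIntegral.continuousOn_primitive_interval (μ := volume) (f := a) (a := a0) (b := a1)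
      (by rw [uIcc_of_le h.le, integrableOn_Icc_iff_integrableOn_Ioo]; exact hi)
    rwa [uIcc_of_le h.le] at this
  have hFd : ∀ t ∈ Ioo a0 a1, HasDerivAt F (a t) t := by
    intro t ht
    apply intervalIntegral.integral_hasDerivAt_right
    · exact hii.mono_set (by rw [uIcc_of_le h.le, uIcc_of_le ht.1.le]; exact Icc_subset_Icc le_rfl ht.2.le)
    · exact hc.stronglyMeasurableAtFilter isOpen_Ioo t ht
    · exact hc.continuousAt (isOpen_Ioo.mem_nhds ht)
  have hFm : StrictMonoOn F (Icc a0 a1) := by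
    apply strictMonoOn_of_deriv_pos (convex_Icc _ _) hFc
    intro t ht
    rw [interior_Icc] at ht
    rw [(hFd t ht).deriv]; exact hp t ht
  have hα0 : 0 < α := by
    rw [← hF1, ← hF0]; exact hFm (left_mem_Icc.2 h.le) (right_mem_Icc.2 h.le) h
  refine ⟨hα0, ?_⟩
  have hex : ∀ s : ℝ, ∃ t, s ∈ Ioo (0:ℝ) 1 → t ∈ Ioo a0 a1 ∧ F t = s * α := by
    intro s
    by_cases hs : s ∈ Ioo (0:ℝ) 1
    · have := intermediate_value_Ioo h.le hFc
      rw [hF0, hF1] at this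
      obtain ⟨t, ht, e⟩ := this (show s * α ∈ Ioo 0 α from ⟨mul_pos hs.1 hα0, by nlinarith [hs.2]⟩)
      exact ⟨t, fun _ => ⟨ht, e⟩⟩
    · exact ⟨0, fun h => absurd h hs⟩
  choose φ hφ using hex
  have hsurj : ∀ t ∈ Ioo a0 a1, ∃ s ∈ Ioo (0:ℝ) 1, φ s = t := by
    intro t ht
    have htc := Ioo_subset_Icc_self ht
    have h1 : 0 < F t := by rw [← hF0]; exact hFm (left_mem_Icc.2 h.le) htc ht.1
    have h2 : F t < α := by rw [← hF1]; exact hFm htc (right_mem_Icc.2 h.le) ht.2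
    have hs : F t / α ∈ Ioo (0:ℝ) 1 := ⟨div_pos h1 hα0, by rwa [div_lt_one hα0]⟩
    refine ⟨F t / α, hs, ?_⟩
    obtain ⟨h3, h4⟩ := hφ _ hs
    apply hFm.injOn (Ioo_subset_Icc_self h3) htc
    rw [h4]; field_simp
  have hmono : MonotoneOn φ (Ioo 0 1) := by
    intro s hs t ht hst
    obtain ⟨h1, h2⟩ := hφ s hs
    obtain ⟨h3, h4⟩ := hφ t ht
    rw [← hFm.le_iff_le (Ioo_subset_Icc_self h1) (Ioo_subset_Icc_self h3), h2, h4]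
    exact mul_le_mul_of_nonneg_right hst hα0.le
  refine ⟨φ, fun s hs => ⟨(hφ s hs).1, ?_⟩, hsurj⟩
  have hcont : ContinuousAt φ s := by
    apply continuousAt_of_monotoneOn_of_image_mem_nhds hmono (isOpen_Ioo.mem_nhds hs)
    apply Filter.mem_of_superset (isOpen_Ioo.mem_nhds (hφ s hs).1)
    intro t ht
    obtain ⟨s, hs, e⟩ := hsurj t ht
    exact ⟨s, hs, e⟩
  have hd : HasDerivAt (fun t => F t / α) (a (φ s) / α) (φ s) := (hFd _ (hφ s hs).1).div_const α
  have := hd.of_local_left_inverse (g := φ) hcont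
    (div_pos (hp _ (hφ s hs).1) hα0).ne' (by
      filter_upwards [isOpen_Ioo.mem_nhds hs] with t ht
      rw [(hφ t ht).2]; field_simp)
  rwa [inv_div] at this

lemma transport (a b : ℝ → ℝ) (c : ℝ → ℝ≥0∞) (a0 a1 b0 b1 : ℝ) (ha : a0 < a1) (hb : b0 < b1)
    (hca : ContinuousOn a (Ioo a0 a1)) (hpa : ∀ t ∈ Ioo a0 a1, 0 < a t)
    (hia : IntegrableOn a (Ioo a0 a1))
    (hcb : ContinuousOn b (Ioo b0 b1)) (hpb : ∀ t ∈ Ioo b0 b1, 0 < b t)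
    (hib : IntegrableOn b (Ioo b0 b1)) (α β : ℝ)
    (hα : α = ∫ t in Ioo a0 a1, a t) (hβ : β = ∫ t in Ioo b0 b1, b t)
    (hcc : ∀ x ∈ Ioo a0 a1, ∀ y ∈ Ioo b0 b1, ENNReal.ofReal (√(a x * b y)) ≤ c ((x + y) / 2)) :
    ENNReal.ofReal (√(α * β)) ≤ ∫⁻ t, c t ∧
    (α = β → ∫⁻ t, c t ≤ ENNReal.ofReal α → ∃ k, b0 = a0 + k ∧ b1 = a1 + k ∧
      ∀ y ∈ Ioo b0 b1, b y = a (y - k)) := by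
  obtain ⟨hα0, φ, hφ, hφs⟩ := quantile a a0 a1 ha hca hpa hia α hα
  obtain ⟨hβ0, ψ, hψ, hψs⟩ := quantile b b0 b1 hb hcb hpb hib β hβ
  set g : ℝ → ℝ := fun s => (α / a (φ s) + β / b (ψ s)) / 2 * √(a (φ s) * b (ψ s)) with hg
  have hσ : ∀ s ∈ Ioo (0:ℝ) 1, HasDerivAt (fun s => (φ s + ψ s) / 2) ((α / a (φ s) + β / b (ψ s)) / 2) s :=
    fun s hs => ((hφ s hs).2.add (hψ s hs).2).div_const 2
  have hpos : ∀ s ∈ Ioo (0:ℝ) 1, 0 < (α / a (φ s) + β / b (ψ s)) / 2 := by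
    intro s hs
    have := hpa _ (hφ s hs).1
    have := hpb _ (hψ s hs).1
    positivity
  have hinj : InjOn (fun s => (φ s + ψ s) / 2) (Ioo (0:ℝ) 1) := by
    apply StrictMonoOn.injOn
    apply strictMonoOn_of_deriv_pos (convex_Ioo _ _)
    · exact fun s hs => (hσ s hs).continuousAt.continuousWithinAt
    · intro s hs
      rw [interior_Ioo] at hs
      rw [(hσ s hs).deriv]; exact hpos s hs
  have hint : ∫⁻ s in Ioo (0:ℝ) 1, ENNReal.ofReal (g s) ≤ ∫⁻ t, c t := by
    calc ∫⁻ s in Ioo (0:ℝ) 1, ENNReal.ofReal (g s)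
        ≤ ∫⁻ s in Ioo (0:ℝ) 1, ENNReal.ofReal |(α / a (φ s) + β / b (ψ s)) / 2| * c ((φ s + ψ s) / 2) := by
          apply setLIntegral_mono' measurableSet_Ioo
          intro s hs
          rw [abs_of_pos (hpos s hs), hg, ENNReal.ofReal_mul (hpos s hs).le]
          gcongr
          exact hcc _ (hφ s hs).1 _ (hψ s hs).1
      _ = ∫⁻ t in (fun s => (φ s + ψ s) / 2) '' (Ioo (0:ℝ) 1), c t :=
          (lintegral_image_eq_lintegral_abs_deriv_mul measurableSet_Ioo
            (fun s hs => (hσ s hs).hasDerivWithinAt) hinj c).symm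
      _ ≤ _ := setLIntegral_le_lintegral _ _
  have hgl : ∀ s ∈ Ioo (0:ℝ) 1, √(α * β) ≤ g s := by
    intro s hs
    have h1 := hpa _ (hφ s hs).1
    have h2 := hpb _ (hψ s hs).1
    apply Real.sqrt_le_iff.2 ⟨mul_nonneg (hpos s hs).le (Real.sqrt_nonneg _), ?_⟩
    rw [mul_pow, Real.sq_sqrt (by positivity)]
    have : ((α / a (φ s) + β / b (ψ s)) / 2)^2 * (a (φ s) * b (ψ s)) - α * β =
      ((α / a (φ s) - β / b (ψ s)) / 2)^2 * (a (φ s) * b (ψ s)) := by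
      field_simp; ring
    have : 0 ≤ ((α / a (φ s) - β / b (ψ s)) / 2)^2 * (a (φ s) * b (ψ s)) := by positivity
    linarith
  have hvol : ∀ r : ℝ, ∫⁻ s in Ioo (0:ℝ) 1, ENNReal.ofReal r = ENNReal.ofReal r := by
    intro r; simp
  refine ⟨?_, ?_⟩
  · refine le_trans ?_ hint
    rw [← hvol]
    apply setLIntegral_mono' measurableSet_Ioo
    intro s hs
    exact ENNReal.ofReal_le_ofReal (hgl s hs)
  · rintro rfl hle
    have hcφ : ContinuousOn φ (Ioo 0 1) := fun s hs => (hφ s hs).2.continuousAt.continuousWithinAt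
    have hcψ : ContinuousOn ψ (Ioo 0 1) := fun s hs => (hψ s hs).2.continuousAt.continuousWithinAt
    have hcaφ : ContinuousOn (fun s => a (φ s)) (Ioo 0 1) := hca.comp hcφ (fun s hs => (hφ s hs).1)
    have hcbψ : ContinuousOn (fun s => b (ψ s)) (Ioo 0 1) := hcb.comp hcψ (fun s hs => (hψ s hs).1)
    have hgc : ContinuousOn g (Ioo 0 1) := by
      apply ContinuousOn.mul
      · apply ContinuousOn.div_const
        exact (continuousOn_const.div hcaφ fun s hs => (hpa _ (hφ s hs).1).ne').add
          (continuousOn_const.div hcbψ fun s hs => (hpb _ (hψ s hs).1).ne')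
      · exact (hcaφ.mul hcbψ).sqrt
    have hss : √(α * α) = α := Real.sqrt_mul_self hα0.le
    rw [hss] at hgl
    have hae : (fun _ => ENNReal.ofReal α) =ᵐ[volume.restrict (Ioo (0:ℝ) 1)] fun s => ENNReal.ofReal (g s) := by
      apply ae_eq_of_ae_le_of_lintegral_le
      · filter_upwards [ae_restrict_mem measurableSet_Ioo] with s hs
        exact ENNReal.ofReal_le_ofReal (hgl s hs)
      · rw [hvol]; exact ENNReal.ofReal_ne_top
      · exact (hgc.aemeasurable measurableSet_Ioo).ennreal_ofReal
      · rw [hvol]; exact hint.trans hle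
    have heq : EqOn (fun _ => α) g (Ioo 0 1) := by
      refine Measure.eqOn_open_of_ae_eq (μ := volume) ?_ isOpen_Ioo continuousOn_const hgc
      filter_upwards [hae, ae_restrict_mem measurableSet_Ioo] with s hs hs'
      have := congrArg ENNReal.toReal hs
      rwa [ENNReal.toReal_ofReal hα0.le, ENNReal.toReal_ofReal (hα0.le.trans (hgl s hs'))] at this
    have hab : ∀ s ∈ Ioo (0:ℝ) 1, a (φ s) = b (ψ s) := by
      intro s hs
      have h1 := hpa _ (hφ s hs).1
      have h2 := hpb _ (hψ s hs).1
      have h3 : α = g s := heq hs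
      have h4 : α ^ 2 = ((α / a (φ s) + α / b (ψ s)) / 2)^2 * (a (φ s) * b (ψ s)) := by
        conv_lhs => rw [h3, hg]
        simp only []
        rw [mul_pow, Real.sq_sqrt (by positivity)]
      have : ((α / a (φ s) + α / b (ψ s)) / 2)^2 * (a (φ s) * b (ψ s)) - α ^ 2 =
        α ^ 2 * (a (φ s) - b (ψ s)) ^ 2 / (4 * (a (φ s) * b (ψ s))) := by
        field_simp; ring
      have h5 : α ^ 2 * (a (φ s) - b (ψ s)) ^ 2 / (4 * (a (φ s) * b (ψ s))) = 0 := by linarith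
      rw [div_eq_zero_iff] at h5
      rcases h5 with h5 | h5
      · have := (mul_eq_zero.1 h5).resolve_left (by positivity)
        have := pow_eq_zero_iff (two_ne_zero) |>.1 this
        linarith
      · exact absurd h5 (by positivity)
    have hconst : ∀ s ∈ Ioo (0:ℝ) 1, ψ s - φ s = ψ (1/2) - φ (1/2) := by
      intro s hs
      have hd : ∀ s ∈ Ioo (0:ℝ) 1, HasDerivAt (fun s => ψ s - φ s) 0 s := by
        intro s hs
        have := (hψ s hs).2.sub (hφ s hs).2
        rw [hab s hs, sub_self] at this
        exact this
      exact (isOpen_Ioo).is_const_of_deriv_eq_zero isPreconnected_Ioo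
        (fun s hs => (hd s hs).differentiableAt.differentiableWithinAt)
        (fun s hs => (hd s hs).deriv) hs (by norm_num)
    set k := ψ (1/2) - φ (1/2) with hk
    have hab1 : ∀ t, t ∈ Ioo a0 a1 → t + k ∈ Ioo b0 b1 := by
      intro t ht
      obtain ⟨s, hs, rfl⟩ := hφs t ht
      rw [← hconst s hs]
      simpa using (hψ s hs).1
    have hab2 : ∀ t, t ∈ Ioo b0 b1 → t - k ∈ Ioo a0 a1 ∧ b t = a (t - k) := by
      intro t ht
      obtain ⟨s, hs, rfl⟩ := hψs t ht
      rw [← hconst s hs]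
      simpa using ⟨(hφ s hs).1, (hab s hs).symm⟩
    have hI : Ioo (a0 + k) (a1 + k) = Ioo b0 b1 := by
      ext t
      constructor
      · intro ht
        have := hab1 (t - k) ⟨by linarith [ht.1], by linarith [ht.2]⟩
        simpa using this
      · intro ht
        have := (hab2 t ht).1
        exact ⟨by linarith [this.1], by linarith [this.2]⟩
    have hcl := congrArg closure hI
    rw [closure_Ioo (by linarith : a0 + k < a1 + k).ne, closure_Ioo hb.ne, Icc_eq_Icc_iff (by linarith)] at hcl
    exact ⟨k, hcl.1.symm, hcl.2.symm, fun y hy => (hab2 y hy).2⟩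

def marg {d : ℕ} (K : Set (ℝ × (Fin d → ℝ))) (t : ℝ) : ℝ := (volume (Prod.mk t ⁻¹' K)).toReal

lemma sec_compact {d : ℕ} {K : Set (ℝ × (Fin d → ℝ))} (hK : IsCompact K) (t : ℝ) :
    IsCompact (Prod.mk t ⁻¹' K) := by
  have : Prod.mk t ⁻¹' K = Prod.snd '' (K ∩ Prod.fst ⁻¹' {t}) := by
    ext y
    constructor
    · intro hy; exact ⟨(t, y), ⟨hy, rfl⟩, rfl⟩
    · rintro ⟨⟨u, z⟩, ⟨h1, h2⟩, rfl⟩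
      have h2 : u = t := h2
      subst h2; exact h1
  rw [this]
  exact (hK.inter_right (isClosed_singleton.preimage continuous_fst)).image continuous_snd

lemma sec_convex {d : ℕ} {K : Set (ℝ × (Fin d → ℝ))} (hK : Convex ℝ K) (t : ℝ) :
    Convex ℝ (Prod.mk t ⁻¹' K) := by
  intro x hx y hy p q hp hq hpq
  have := hK hx hy hp hq hpq
  simp only [Prod.smul_mk, Prod.mk_add_mk, smul_eq_mul, ← add_mul, hpq, one_mul] at this
  exact this

lemma marg_scale {d : ℕ} {K : Set (ℝ × (Fin d → ℝ))} (hK : IsCompact K) (hc : Convex ℝ K)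
    (p : ℝ × (Fin d → ℝ)) (hp : p ∈ K) (t ε : ℝ) (h0 : 0 ≤ ε) (h1 : ε ≤ 1) :
    (1 - ε) ^ d * marg K t ≤ marg K ((1 - ε) * t + ε * p.1) := by
  have hsub : AffineMap.homothety p.2 (1 - ε) '' (Prod.mk t ⁻¹' K) ⊆
      Prod.mk ((1 - ε) * t + ε * p.1) ⁻¹' K := by
    rintro _ ⟨y, hy, rfl⟩
    have := hc hy hp (sub_nonneg.2 h1) h0 (by ring)
    have e : AffineMap.homothety p.2 (1 - ε) y = (1 - ε) • y + ε • p.2 := by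
      rw [AffineMap.homothety_apply]; ext i; simp; ring
    change (_, _) ∈ K
    rw [e]
    convert this using 1
    rfl
  have hm := measure_mono (μ := (volume : Measure (Fin d → ℝ))) hsub
  rw [Measure.addHaar_image_homothety] at hm
  have := ENNReal.toReal_mono (sec_compact hK _).measure_lt_top.ne hm
  rw [ENNReal.toReal_mul, ENNReal.toReal_ofReal (abs_nonneg _)] at this
  simp only [Module.finrank_fintype_fun_eq_card, Fintype.card_fin] at this
  rwa [abs_of_nonneg (pow_nonneg (sub_nonneg.2 h1) _)] at this

lemma marg_nonneg {d : ℕ} (K : Set (ℝ × (Fin d → ℝ))) (t : ℝ) : 0 ≤ marg K t :=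
  ENNReal.toReal_nonneg

lemma marg_integral {d : ℕ} {K : Set (ℝ × (Fin d → ℝ))} (hK : IsCompact K) (g : ℝ → ℝ)
    (hg : Continuous g) : Integrable (fun t => g t * marg K t) ∧
      ∫ p in K, g p.1 = ∫ t, g t * marg K t := by
  have hi : Integrable (K.indicator (fun p => g p.1))
      ((volume : Measure ℝ).prod (volume : Measure (Fin d → ℝ))) := by
    rw [integrable_indicator_iff hK.measurableSet, ← Measure.volume_eq_prod]
    exact (hg.comp continuous_fst).continuousOn.integrableOn_compact hK
  have he : ∀ t, ∫ y, K.indicator (fun p => g p.1) (t, y) = g t * marg K t := by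
    intro t
    have : (fun y => K.indicator (fun p => g p.1) (t, y)) =
      (Prod.mk t ⁻¹' K).indicator (fun _ => g t) := by
      ext y; simp [Set.indicator]; rfl
    rw [this, integral_indicator_const _ (sec_compact hK t).measurableSet, smul_eq_mul, mul_comm]
    rfl
  constructor
  · have := hi.integral_prod_left
    simpa only [he] using this
  · rw [← integral_indicator hK.measurableSet, Measure.volume_eq_prod, integral_prod _ hi]
    simp only [he]

lemma marg_facts {d : ℕ} {K : Set (ℝ × (Fin d → ℝ))} (hK : IsCompact K) (hc : Convex ℝ K)
    (hv : volume K ≠ 0) : ∃ a0 a1 : ℝ, a0 < a1 ∧ (∀ p ∈ K, a0 ≤ p.1 ∧ p.1 ≤ a1) ∧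
      (∃ p ∈ K, p.1 = a0) ∧ (∃ p ∈ K, p.1 = a1) ∧ ContinuousOn (marg K) (Ioo a0 a1) ∧
      (∀ t ∈ Ioo a0 a1, 0 < marg K t) ∧ IntegrableOn (marg K) (Ioo a0 a1) ∧
      ((volume K).toReal = ∫ t in Ioo a0 a1, marg K t) ∧
      ∫ p in K, p.1 = ∫ t in Ioo a0 a1, t * marg K t := by
  have hne : K.Nonempty := by
    by_contra h
    rw [not_nonempty_iff_eq_empty] at h
    simp [h] at hv
  obtain ⟨p0, hp0, hmin⟩ := hK.exists_isMinOn hne continuous_fst.continuousOn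
  obtain ⟨p1, hp1, hmax⟩ := hK.exists_isMaxOn hne continuous_fst.continuousOn
  have hb : ∀ p ∈ K, p0.1 ≤ p.1 ∧ p.1 ≤ p1.1 := fun p hp => ⟨hmin hp, hmax hp⟩
  have hmem : ∀ t ∈ Icc p0.1 p1.1, ∃ p ∈ K, p.1 = t := by
    have h1 : Convex ℝ (Prod.fst '' K) := hc.linear_image (LinearMap.fst ℝ ℝ (Fin d → ℝ))
    intro t ht
    have := h1.ordConnected.out ⟨p0, hp0, rfl⟩ ⟨p1, hp1, rfl⟩ ht
    exact this
  have hz : ∀ t, t ∉ Icc p0.1 p1.1 → marg K t = 0 := by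
    intro t ht
    have : Prod.mk t ⁻¹' K = ∅ := by
      ext y
      simp only [mem_preimage, mem_empty_iff_false, iff_false]
      intro h
      exact ht (hb _ h)
    simp [marg, this]
  have hint : ∀ g : ℝ → ℝ, Continuous g → ∫ p in K, g p.1 = ∫ t in Ioo p0.1 p1.1, g t * marg K t := by
    intro g hg
    rw [(marg_integral hK g hg).2, ← integral_Icc_eq_integral_Ioo,
      setIntegral_eq_integral_of_forall_compl_eq_zero]
    intro t ht; rw [hz t ht, mul_zero]
  have hvol : (volume K).toReal = ∫ t in Ioo p0.1 p1.1, marg K t := by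
    have := hint (fun _ => 1) continuous_const
    simpa [Measure.real] using this
  have hvpos : 0 < (volume K).toReal := ENNReal.toReal_pos hv hK.measure_lt_top.ne
  have hstar : ∃ t ∈ Ioo p0.1 p1.1, 0 < marg K t := by
    by_contra! hcon
    have : ∫ t in Ioo p0.1 p1.1, marg K t ≤ 0 := setIntegral_nonpos measurableSet_Ioo hcon
    linarith
  obtain ⟨ts, hts, hts0⟩ := hstar
  have hr : ∀ t t' r : ℝ, 0 < r → Icc (t - r) (t + r) ⊆ Icc p0.1 p1.1 → |t' - t| ≤ r →
      (1 - |t' - t| / r) ^ d * marg K t ≤ marg K t' := by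
    intro t t' r hr hsub hle
    have hε : |t' - t| / r ≤ 1 := by rwa [div_le_one hr]
    rcases le_total t t' with h | h
    · obtain ⟨p, hp, e⟩ := hmem _ (hsub (right_mem_Icc.2 (by linarith)))
      have := marg_scale hK hc p hp t _ (div_nonneg (abs_nonneg _) hr.le) hε
      convert this using 2
      rw [e, abs_of_nonneg (by linarith)]
      field_simp; ring
    · obtain ⟨p, hp, e⟩ := hmem _ (hsub (left_mem_Icc.2 (by linarith)))
      have := marg_scale hK hc p hp t _ (div_nonneg (abs_nonneg _) hr.le) hε
      convert this using 2
      rw [e, abs_of_nonpos (by linarith)]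
      field_simp; ring
  refine ⟨p0.1, p1.1, hts.1.trans hts.2, hb, ⟨p0, hp0, rfl⟩, ⟨p1, hp1, rfl⟩, ?_, ?_, ?_, hvol, hint _ continuous_id⟩
  · intro t ht
    apply ContinuousAt.continuousWithinAt
    obtain ⟨r, hr0, hrs⟩ : ∃ r : ℝ, 0 < r ∧ Icc (t - 2 * r) (t + 2 * r) ⊆ Icc p0.1 p1.1 := by
      refine ⟨min (t - p0.1) (p1.1 - t) / 2, by
        have := lt_min (sub_pos.2 ht.1) (sub_pos.2 ht.2); positivity, ?_⟩
      apply Icc_subset_Icc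
      · linarith [min_le_left (t - p0.1) (p1.1 - t)]
      · linarith [min_le_right (t - p0.1) (p1.1 - t)]
    have hev : ∀ᶠ t' in nhds t, |t' - t| < r := by
      have := Metric.ball_mem_nhds t hr0
      filter_upwards [this] with t' ht'
      rwa [Metric.mem_ball, Real.dist_eq] at ht'
    have hδ : Filter.Tendsto (fun t' => (1 - |t' - t| / r) ^ d) (nhds t) (nhds 1) := by
      have : ContinuousAt (fun t' => (1 - |t' - t| / r) ^ d) t := by fun_prop
      simpa [ContinuousAt] using this
    have l1 : Filter.Tendsto (fun t' => (1 - |t' - t| / r) ^ d * marg K t) (nhds t) (nhds (marg K t)) := by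
      simpa using hδ.mul_const (marg K t)
    have l2 : Filter.Tendsto (fun t' => marg K t / (1 - |t' - t| / r) ^ d) (nhds t) (nhds (marg K t)) := by
      have := (tendsto_const_nhds (x := marg K t)).div hδ one_ne_zero
      rw [div_one] at this
      exact this
    refine tendsto_of_tendsto_of_tendsto_of_le_of_le' l1 l2 ?_ ?_
    · filter_upwards [hev] with t' ht'
      exact hr t t' r hr0 ((Icc_subset_Icc (by linarith) (by linarith)).trans hrs) ht'.le
    · filter_upwards [hev] with t' ht'
      have hlt : |t' - t| / r < 1 := by rwa [div_lt_one hr0]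
      rw [le_div_iff₀ (pow_pos (by linarith) _), mul_comm]
      have h3 := abs_lt.1 ht'
      have := hr t' t r hr0 ((Icc_subset_Icc (by linarith) (by linarith)).trans hrs)
        (by rw [abs_sub_comm]; exact ht'.le)
      rwa [abs_sub_comm] at this
  · intro t ht
    rcases lt_trichotomy t ts with h | h | h
    · have hlt : (ts - t) / (ts - p0.1) < 1 := by
        rw [div_lt_one (by linarith [hts.1])]; linarith [ht.1]
      have := marg_scale hK hc p0 hp0 ts ((ts - t) / (ts - p0.1))
        (div_nonneg (by linarith) (by linarith [hts.1])) hlt.le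
      have e : (1 - (ts - t) / (ts - p0.1)) * ts + (ts - t) / (ts - p0.1) * p0.1 = t := by
        have : ts - p0.1 ≠ 0 := by linarith [hts.1]
        field_simp; ring
      rw [e] at this
      exact lt_of_lt_of_le (mul_pos (pow_pos (by linarith) _) hts0) this
    · rw [h]; exact hts0
    · have hlt : (t - ts) / (p1.1 - ts) < 1 := by
        rw [div_lt_one (by linarith [hts.2])]; linarith [ht.2]
      have := marg_scale hK hc p1 hp1 ts ((t - ts) / (p1.1 - ts))
        (div_nonneg (by linarith) (by linarith [hts.2])) hlt.le
      have e : (1 - (t - ts) / (p1.1 - ts)) * ts + (t - ts) / (p1.1 - ts) * p1.1 = t := by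
        have : p1.1 - ts ≠ 0 := by linarith [hts.2]
        field_simp; ring
      rw [e] at this
      exact lt_of_lt_of_le (mul_pos (pow_pos (by linarith) _) hts0) this
  · have := (marg_integral hK (fun _ => 1) continuous_const).1
    simp only [one_mul] at this
    exact this.integrableOn

def BM (d : ℕ) : Prop := ∀ A B C : Set (Fin d → ℝ), IsCompact A → IsCompact B → IsCompact C →
  Convex ℝ A → Convex ℝ B → (∀ x ∈ A, ∀ y ∈ B, (1/2:ℝ) • (x + y) ∈ C) →
  √((volume A).toReal * (volume B).toReal) ≤ (volume C).toReal

lemma bm_step {d : ℕ} (hd : BM d) (A B C : Set (ℝ × (Fin d → ℝ))) (hA : IsCompact A)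
    (hB : IsCompact B) (hC : IsCompact C) (cA : Convex ℝ A) (cB : Convex ℝ B)
    (h : ∀ x ∈ A, ∀ y ∈ B, (1/2:ℝ) • (x + y) ∈ C) (vA : volume A ≠ 0) (vB : volume B ≠ 0) :
    √((volume A).toReal * (volume B).toReal) ≤ (volume C).toReal ∧
    (volume A = volume B → volume C ≤ volume A → ∃ k : ℝ,
      (∀ p ∈ B, ∃ q ∈ A, p.1 ≤ q.1 + k) ∧ (∀ q ∈ A, ∃ p ∈ B, q.1 + k ≤ p.1) ∧
      ∫ p in B, p.1 = (∫ p in A, p.1) + k * (volume A).toReal) := by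
  obtain ⟨a0, a1, ha, hab, ⟨p0, hp0, hp0'⟩, ⟨p1, hp1, hp1'⟩, hac, hap, hai, haI, haJ⟩ := marg_facts hA cA vA
  obtain ⟨b0, b1, hb, hbb, ⟨q0, hq0, hq0'⟩, ⟨q1, hq1, hq1'⟩, hbc, hbp, hbi, hbI, hbJ⟩ := marg_facts hB cB vB
  have hCi : ∫⁻ t, volume (Prod.mk t ⁻¹' C) = volume C := by
    rw [Measure.volume_eq_prod, Measure.prod_apply hC.measurableSet]
  have htr := transport (marg A) (marg B) (fun t => volume (Prod.mk t ⁻¹' C)) a0 a1 b0 b1 ha hb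
    hac hap hai hbc hbp hbi _ _ haI hbI (by
      intro x _ y _
      rw [ENNReal.ofReal_le_iff_le_toReal (sec_compact hC _).measure_lt_top.ne]
      refine hd _ _ _ (sec_compact hA x) (sec_compact hB y) (sec_compact hC _) (sec_convex cA x)
        (sec_convex cB y) ?_
      intro u hu v hv
      have := h _ hu _ hv
      change (_, _) ∈ C
      convert this using 1
      simp; ring)
  rw [hCi] at htr
  refine ⟨?_, ?_⟩
  · rw [← ENNReal.ofReal_le_iff_le_toReal hC.measure_lt_top.ne]; exact htr.1
  · intro e1 e2
    obtain ⟨k, h0, h1, hk⟩ := htr.2 (by rw [e1]) (by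
      rw [ENNReal.ofReal_toReal hA.measure_lt_top.ne]; exact e2)
    refine ⟨k, ?_, ?_, ?_⟩
    · intro p hp
      exact ⟨p1, hp1, by rw [hp1', ← h1]; exact (hbb p hp).2⟩
    · intro q hq
      exact ⟨q1, hq1, by rw [hq1', h1]; linarith [(hab q hq).2]⟩
    · rw [hbJ, haJ, haI]
      have e : ∫ t in Ioo b0 b1, t * marg B t = ∫ t in Ioo b0 b1, ((t - k) + k) * marg A (t - k) := by
        apply setIntegral_congr_fun measurableSet_Ioo
        intro t ht
        simp only [hk t ht, sub_add_cancel]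
      rw [e, ← integral_Ioc_eq_integral_Ioo, ← intervalIntegral.integral_of_le hb.le,
        intervalIntegral.integral_comp_sub_right (fun t => (t + k) * marg A t),
        h0, h1, add_sub_cancel_right, add_sub_cancel_right,
        intervalIntegral.integral_of_le ha.le, integral_Ioc_eq_integral_Ioo, ← integral_const_mul,
        ← integral_add]
      · congr 1; ext t; ring
      · exact (marg_integral hA _ continuous_id).1.integrableOn
      · exact hai.const_mul k

lemma exists_equiv {E : Type} [NormedAddCommGroup E] [NormedSpace ℝ E] [FiniteDimensional ℝ E]
    {d : ℕ} (hd : Module.finrank ℝ E = d + 1) (l : E →ₗ[ℝ] ℝ) (hl : l ≠ 0) :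
    ∃ L : E ≃L[ℝ] ℝ × (Fin d → ℝ), ∀ x, (L x).1 = l x := by
  have h1 := Module.Dual.finrank_ker_add_one_of_ne_zero (f := l) hl
  have h2 : Module.finrank ℝ (LinearMap.ker l) = Module.finrank ℝ (Fin d → ℝ) := by
    rw [Module.finrank_fin_fun]; omega
  let κ := LinearEquiv.ofFinrankEq _ _ h2
  obtain ⟨g, hg⟩ := LinearMap.exists_extend (κ : LinearMap.ker l →ₗ[ℝ] (Fin d → ℝ))
  have hinj : Function.Injective (l.prod g) := by
    rw [← LinearMap.ker_eq_bot, LinearMap.ker_eq_bot']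
    intro x hx
    have hx1 : l x = 0 := congrArg Prod.fst hx
    have hx2 : g x = 0 := congrArg Prod.snd hx
    have : κ ⟨x, hx1⟩ = 0 := by
      rw [← hx2]; exact (LinearMap.congr_fun hg ⟨x, hx1⟩).symm
    rw [LinearEquiv.map_eq_zero_iff] at this
    exact congrArg Subtype.val this
  exact ⟨(LinearEquiv.ofInjectiveOfFinrankEq (l.prod g) hinj (by simp [hd, add_comm])).toContinuousLinearEquiv,
    fun x => rfl⟩

lemma haar_transfer {E : Type} [NormedAddCommGroup E] [NormedSpace ℝ E] [FiniteDimensional ℝ E]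
    [MeasurableSpace E] [BorelSpace E] (μ : Measure E) [μ.IsAddHaarMeasure] {d : ℕ}
    (L : E ≃L[ℝ] ℝ × (Fin d → ℝ)) :
    ∃ c : ℝ≥0∞, c ≠ 0 ∧ c ≠ ∞ ∧ (∀ S, μ S = c * volume (L '' S)) ∧
      ∀ S, ∫ x in S, (L x).1 ∂μ = c.toReal * ∫ p in L '' S, p.1 := by
  have : (μ.map L).IsAddHaarMeasure := L.isAddHaarMeasure_map μ
  have hvh : (volume : Measure (ℝ × (Fin d → ℝ))).IsAddHaarMeasure := by
    rw [Measure.volume_eq_prod]; infer_instance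
  obtain ⟨c, c0, ct, hc⟩ : ∃ c : ℝ≥0∞, c ≠ 0 ∧ c ≠ ∞ ∧
      μ.map L = c • (volume : Measure (ℝ × (Fin d → ℝ))) := by
    refine ⟨(Measure.addHaarScalarFactor (μ.map L) volume : ℝ≥0), ?_, ENNReal.coe_ne_top, ?_⟩
    · exact_mod_cast (Measure.addHaarScalarFactor_pos_of_isAddHaarMeasure _ _).ne'
    · exact Measure.isAddLeftInvariant_eq_smul (μ.map L) volume
  let e : E ≃ᵐ ℝ × (Fin d → ℝ) := L.toHomeomorph.toMeasurableEquiv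
  have he : μ.map L = μ.map e := rfl
  have hpre : ∀ S, e ⁻¹' (L '' S) = S := fun S => preimage_image_eq S L.injective
  refine ⟨c, c0, ct, fun S => ?_, fun S => ?_⟩
  · have : (μ.map L) (L '' S) = c * volume (L '' S) := by rw [hc]; rfl
    rw [← this, he, e.map_apply, hpre]
  · have h1 : ∫ p in L '' S, p.1 ∂(μ.map L) = ∫ x in S, (L x).1 ∂μ := by
      rw [he, e.measurableEmbedding.setIntegral_map, hpre]; rfl
    rw [← h1, hc, Measure.restrict_smul, integral_smul_measure, smul_eq_mul]

lemma bm_all (d : ℕ) : BM d := by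
  induction d with
  | zero =>
    intro A B C _ _ _ _ _ h
    rcases A.eq_empty_or_nonempty with rfl | ⟨x, hx⟩
    · simp
    rcases B.eq_empty_or_nonempty with rfl | ⟨y, hy⟩
    · simp
    have hu : ∀ (S : Set (Fin 0 → ℝ)) (x), x ∈ S → S = univ := by
      intro S x hx; ext y; simp [Subsingleton.elim y x, hx]
    rw [hu A x hx, hu B y hy, hu C _ (h x hx y hy)]
    simp
  | succ d ih =>
    intro A B C hA hB hC cA cB h
    by_cases vA : volume A = 0
    · simp [vA]
    by_cases vB : volume B = 0
    · simp [vB]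
    obtain ⟨L, -⟩ := exists_equiv (E := Fin (d+1) → ℝ) (d := d) (by simp) (LinearMap.proj 0) (by
      intro h0
      have := LinearMap.congr_fun h0 (fun _ => 1)
      simp at this)
    obtain ⟨c, c0, ct, hc, -⟩ := haar_transfer volume L
    have := (bm_step ih (L '' A) (L '' B) (L '' C) (hA.image L.continuous) (hB.image L.continuous)
      (hC.image L.continuous) (cA.linear_image L.toLinearMap) (cB.linear_image L.toLinearMap)
      (by
        rintro _ ⟨x, hx, rfl⟩ _ ⟨y, hy, rfl⟩
        exact ⟨_, h x hx y hy, by simp⟩)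
      (by intro h0; apply vA; rw [hc, h0, mul_zero])
      (by intro h0; apply vB; rw [hc, h0, mul_zero])).1
    rw [hc A, hc B, hc C]
    simp only [ENNReal.toReal_mul]
    rw [show c.toReal * (volume (L '' A)).toReal * (c.toReal * (volume (L '' B)).toReal) =
      c.toReal ^ 2 * ((volume (L '' A)).toReal * (volume (L '' B)).toReal) by ring,
      Real.sqrt_mul (by positivity), Real.sqrt_sq (by positivity)]
    gcongr

lemma core {E : Type} [NormedAddCommGroup E] [NormedSpace ℝ E] [FiniteDimensional ℝ E]
    [MeasurableSpace E] [BorelSpace E] (μ : Measure E) [μ.IsAddHaarMeasure]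
    (A B C : Set E) (hA : IsCompact A) (hB : IsCompact B) (hC : IsCompact C)
    (cA : Convex ℝ A) (cB : Convex ℝ B) (h : ∀ x ∈ A, ∀ y ∈ B, (1/2:ℝ) • (x + y) ∈ C)
    (vA : μ A ≠ 0) (e1 : μ A = μ B) (e2 : μ C ≤ μ A) :
    ∃ x : E, B = (fun y => y + x) '' A := by
  have hM : 0 < (μ A).toReal := ENNReal.toReal_pos vA hA.measure_lt_top.ne
  set x : E := (μ A).toReal⁻¹ • ((∫ y in B, y ∂μ) - ∫ y in A, y ∂μ) with hx
  have key : ∀ l : E →L[ℝ] ℝ, l ≠ 0 →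
      (∀ p ∈ B, ∃ q ∈ A, l p ≤ l q + l x) ∧ (∀ q ∈ A, ∃ p ∈ B, l q + l x ≤ l p) := by
    intro l hl
    have hl' : (l : E →ₗ[ℝ] ℝ) ≠ 0 := by
      intro h0; apply hl; ext y; exact LinearMap.congr_fun h0 y
    have hnt : Nontrivial E := by
      by_contra hn
      rw [not_nontrivial_iff_subsingleton] at hn
      apply hl; ext y; rw [Subsingleton.elim y 0]; simp
    obtain ⟨d, hd⟩ := Nat.exists_eq_succ_of_ne_zero (Module.finrank_pos (R := ℝ) (M := E)).ne'
    obtain ⟨L, hL⟩ := exists_equiv hd (l : E →ₗ[ℝ] ℝ) hl'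
    obtain ⟨c, c0, ct, hc, hcI⟩ := haar_transfer μ L
    obtain ⟨k, k1, k2, k3⟩ := (bm_step (bm_all d) (L '' A) (L '' B) (L '' C) (hA.image L.continuous)
      (hB.image L.continuous)
      (hC.image L.continuous) (cA.linear_image L.toLinearMap) (cB.linear_image L.toLinearMap)
      (by
        rintro _ ⟨x, hx, rfl⟩ _ ⟨y, hy, rfl⟩
        exact ⟨_, h x hx y hy, by simp⟩)
      (by intro h0; apply vA; rw [hc, h0, mul_zero])
      (by intro h0; apply vA; rw [e1, hc, h0, mul_zero])).2
      (by rw [hc, hc B] at e1; exact (ENNReal.mul_right_inj c0 ct).1 e1)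
      (by rw [hc, hc A] at e2; exact (ENNReal.mul_le_mul_iff_right c0 ct).1 e2)
    have hk : l x = k := by
      have iA : Integrable (fun y : E => y) (μ.restrict A) := continuous_id.continuousOn.integrableOn_compact hA
      have iB : Integrable (fun y : E => y) (μ.restrict B) := continuous_id.continuousOn.integrableOn_compact hB
      have jA := l.integral_comp_comm iA
      have jB := l.integral_comp_comm iB
      have kA := hcI A
      have kB := hcI B
      simp only [hL, ContinuousLinearMap.coe_coe] at kA kB
      rw [hx, map_smul, map_sub, ← jA, ← jB, kA, kB, k3, hc A, ENNReal.toReal_mul, smul_eq_mul]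
      rw [hc A, ENNReal.toReal_mul] at hM
      have hc1 : c.toReal ≠ 0 := (ENNReal.toReal_pos c0 ct).ne'
      have hc2 : (volume (L '' A)).toReal ≠ 0 := fun h0 => by simp [h0] at hM
      field_simp
      ring
    rw [hk]
    constructor
    · intro p hp
      obtain ⟨_, ⟨q, hq, rfl⟩, hle⟩ := k1 _ ⟨p, hp, rfl⟩
      exact ⟨q, hq, by simpa [hL] using hle⟩
    · intro q hq
      obtain ⟨_, ⟨p, hp, rfl⟩, hle⟩ := k2 _ ⟨q, hq, rfl⟩
      exact ⟨p, hp, by simpa [hL] using hle⟩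
  have himg : (fun y => y + x) '' A = (fun y => x + y) '' A := by simp only [add_comm]
  have hAx : IsCompact ((fun y => y + x) '' A) := hA.image (by fun_prop)
  have cAx : Convex ℝ ((fun y => y + x) '' A) := by rw [himg]; exact cA.translate x
  have hneA : A.Nonempty := nonempty_of_measure_ne_zero vA
  have hneB : B.Nonempty := nonempty_of_measure_ne_zero (e1 ▸ vA)
  refine ⟨x, Subset.antisymm ?_ ?_⟩
  · intro b hb
    by_contra hcon
    obtain ⟨l, u, h1, h2⟩ := geometric_hahn_banach_closed_point cAx hAx.isClosed hcon
    have hl : l ≠ 0 := by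
      rintro rfl
      obtain ⟨a, ha⟩ := hneA
      have := h1 _ ⟨a, ha, rfl⟩
      simp at this h2; linarith
    obtain ⟨q, hq, hle⟩ := (key l hl).1 b hb
    have := h1 _ ⟨q, hq, rfl⟩
    simp only [map_add] at this
    linarith
  · rintro _ ⟨q, hq, rfl⟩
    by_contra hcon
    obtain ⟨l, u, h1, h2⟩ := geometric_hahn_banach_closed_point cB hB.isClosed hcon
    have hl : l ≠ 0 := by
      rintro rfl
      obtain ⟨a, ha⟩ := hneB
      have := h1 _ ha
      simp at this h2; linarith
    obtain ⟨p, hp, hle⟩ := (key l hl).2 q hq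
    have := h1 _ hp
    simp only [map_add] at h2
    linarith

/-- if `f_θ` attains its maximum on the whole interval `[s₋, s₊]` for a
full-dimensional convex polytope `P`, then all sections `P ∩ T_{θ,s}` for `s ∈ [s₋, s₊]` are
translates of `P ∩ T_{θ,s₋}` along a common direction. -/
theorem polytope_max_sections_translates {n : ℕ} (hn : 2 ≤ n)
    (P : Set (Euc n)) (hP : IsFullDimPolytope P)
    (θ : Euc n) (hθ : θ ∈ upperHemi n)
    (sm sp : ℝ) (hs : sm < sp)
    (hmax : ∀ s ∈ Set.Icc sm sp, ∀ u : ℝ, fTheta P θ u ≤ fTheta P θ s) :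
    ∃ x : Euc n, ∀ s ∈ Set.Icc sm sp,
      P ∩ hyperplane θ s =
        (fun y => y + ((s - sm) / (sp - sm)) • x) '' (P ∩ hyperplane θ sm) := by
  obtain ⟨⟨W, hW⟩, hint⟩ := hP
  have hPc : IsCompact P := by rw [hW]; exact W.finite_toSet.isCompact_convexHull ℝ
  have hPv : Convex ℝ P := by rw [hW]; exact convex_convexHull ℝ _
  have hθ1 : ‖θ‖ = 1 := hθ.1
  have hθθ : ⟪θ, θ⟫ = 1 := by rw [real_inner_self_eq_norm_sq, hθ1]; norm_num
  let V : Submodule ℝ (Euc n) := (ℝ ∙ θ)ᗮ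
  have hfr : Module.finrank ℝ V + 1 = n := by
    have h1 := Submodule.finrank_add_finrank_orthogonal (ℝ ∙ θ)
    rw [finrank_span_singleton (by rintro rfl; simp at hθ1), finrank_euclideanSpace_fin] at h1
    change Module.finrank ℝ (ℝ ∙ θ)ᗮ + 1 = n
    omega
  have hexp : (n : ℝ) - 1 = (Module.finrank ℝ V : ℝ) := by
    have : (n : ℝ) = (Module.finrank ℝ V : ℝ) + 1 := by exact_mod_cast hfr.symm
    linarith
  have hVθ : ∀ v : V, ⟪(v : Euc n), θ⟫ = 0 := by
    intro v
    exact Submodule.mem_orthogonal_singleton_iff_inner_left.1 v.2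
  let μ : Measure V := μH[(Module.finrank ℝ V : ℝ)]
  have hμ : μ.IsAddHaarMeasure := isAddHaarMeasure_hausdorffMeasure
  let ι : ℝ → V → Euc n := fun s v => (v : Euc n) + s • θ
  have hιi : ∀ s, Isometry (ι s) := fun s => (isometry_add_right (s • θ)).comp isometry_subtype_coe
  let S : ℝ → Set V := fun s => ι s ⁻¹' P
  have himg : ∀ s, ι s '' (S s) = P ∩ hyperplane θ s := by
    intro s
    ext y
    constructor
    · rintro ⟨v, hv, rfl⟩
      refine ⟨hv, ?_⟩
      change ⟪(v : Euc n) + s • θ, θ⟫ = s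
      rw [inner_add_left, hVθ, real_inner_smul_left, hθθ]; ring
    · rintro ⟨hy, hy2⟩
      have hy2 : ⟪y, θ⟫ = s := hy2
      have hv : y - s • θ ∈ V := by
        apply Submodule.mem_orthogonal_singleton_iff_inner_left.2
        rw [inner_sub_left, hy2, real_inner_smul_left, hθθ]; ring
      have e : ι s ⟨y - s • θ, hv⟩ = y := by simp [ι]
      exact ⟨⟨y - s • θ, hv⟩, by change ι s _ ∈ P; rw [e]; exact hy, e⟩
  have hSc : ∀ s, IsCompact (S s) := fun s => (hιi s).isClosedEmbedding.isCompact_preimage hPc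
  have hmid : ∀ s t p q : ℝ, 0 ≤ p → 0 ≤ q → p + q = 1 → ∀ x ∈ S s, ∀ y ∈ S t,
      p • x + q • y ∈ S (p * s + q * t) := by
    intro s t p q hp hq hpq x hx y hy
    have := hPv hx hy hp hq hpq
    change ι _ _ ∈ P
    convert this using 1
    simp only [ι, Submodule.coe_add, Submodule.coe_smul]
    module
  have hSv : ∀ s, Convex ℝ (S s) := by
    intro s x hx y hy p q hp hq hpq
    have := hmid s s p q hp hq hpq x hx y hy
    rwa [← add_mul, hpq, one_mul] at this
  have hvol : ∀ s, sectionVolume P θ s = (μ (S s)).toReal := by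
    intro s
    rw [sectionVolume, ← himg, hexp, (hιi s).hausdorffMeasure_image (Or.inl (by positivity))]
  have hle : ∀ s ∈ Icc sm sp, ∀ u, μ (S u) ≤ μ (S s) := by
    intro s hs u
    have h1 := hmax s hs u
    have hpos : (0:ℝ) < 1 / ((n:ℝ) - 1) := by
      have : (2:ℝ) ≤ n := by exact_mod_cast hn
      apply one_div_pos.2; linarith
    rw [fTheta, fTheta, hvol, hvol, Real.rpow_le_rpow_iff ENNReal.toReal_nonneg ENNReal.toReal_nonneg hpos] at h1
    exact (ENNReal.toReal_le_toReal (hSc u).measure_lt_top.ne (hSc s).measure_lt_top.ne).1 h1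
  have hsm : sm ∈ Icc sm sp := left_mem_Icc.2 hs.le
  have hsp : sp ∈ Icc sm sp := right_mem_Icc.2 hs.le
  have hne : μ (S sm) ≠ 0 := by
    obtain ⟨p, hp⟩ := hint
    have hopen : IsOpen (ι ⟪p, θ⟫ ⁻¹' interior P) := isOpen_interior.preimage (hιi _).continuous
    have hv : p - ⟪p, θ⟫ • θ ∈ V := by
      apply Submodule.mem_orthogonal_singleton_iff_inner_left.2
      rw [inner_sub_left, real_inner_smul_left, hθθ]; ring
    have hnee : (ι ⟪p, θ⟫ ⁻¹' interior P).Nonempty := ⟨⟨p - ⟪p, θ⟫ • θ, hv⟩, by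
      change (p - ⟪p, θ⟫ • θ) + ⟪p, θ⟫ • θ ∈ interior P
      rw [sub_add_cancel]; exact hp⟩
    have h1 := hopen.measure_pos μ hnee
    have h2 : μ (ι ⟪p, θ⟫ ⁻¹' interior P) ≤ μ (S ⟪p, θ⟫) :=
      measure_mono (preimage_mono interior_subset)
    exact (h1.trans_le (h2.trans (hle sm hsm _))).ne'
  have hcore : ∀ s ∈ Icc sm sp, ∃ x : V, S s = (fun y => y + x) '' S sm := by
    intro s hs
    refine core μ (S sm) (S s) (S (1/2 * sm + 1/2 * s)) (hSc _) (hSc _) (hSc _) (hSv _) (hSv _) ?_ hne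
      (le_antisymm (hle s hs _) (hle sm hsm _)) (hle sm hsm _)
    intro x hx y hy
    rw [smul_add]
    exact hmid sm s (1/2) (1/2) (by norm_num) (by norm_num) (by norm_num) x hx y hy
  obtain ⟨x, hx⟩ := hcore sp hsp
  refine ⟨(x : Euc n) + (sp - sm) • θ, fun s hs' => ?_⟩
  set r := (s - sm) / (sp - sm) with hr
  have hd : 0 < sp - sm := by linarith
  have hr0 : 0 ≤ r := div_nonneg (by linarith [hs'.1]) hd.le
  have hr1 : r ≤ 1 := by rw [hr, div_le_one hd]; linarith [hs'.2]
  have hrs : (1 - r) * sm + r * sp = s := by rw [hr]; field_simp; ring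
  have hrd : r * (sp - sm) = s - sm := by rw [hr]; field_simp
  obtain ⟨z, hz⟩ := hcore s hs'
  have hsub : ∀ y ∈ S sm, y + r • x ∈ S s := by
    intro y hy
    have h1 : y + x ∈ S sp := by rw [hx]; exact ⟨y, hy, rfl⟩
    have := hmid sm sp (1 - r) r (by linarith) hr0 (by ring) y hy _ h1
    rw [hrs] at this
    convert this using 1
    module
  have hzx : r • x = z := by
    obtain ⟨y, hy, hymax⟩ := (hSc sm).exists_isMaxOn (nonempty_of_measure_ne_zero hne)
      (f := fun y : V => ⟪y, r • x - z⟫) (by fun_prop)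
    have h1 := hsub y hy
    rw [hz] at h1
    obtain ⟨w, hw, e⟩ := h1
    have e : w + z = y + r • x := e
    have hw' : w = y + (r • x - z) := by rw [← add_sub_assoc, ← e]; simp
    have h2 : ⟪w, r • x - z⟫ ≤ ⟪y, r • x - z⟫ := hymax hw
    rw [hw', inner_add_left] at h2
    have h3 : ⟪r • x - z, r • x - z⟫ ≤ 0 := by linarith
    rw [real_inner_self_nonpos] at h3
    exact sub_eq_zero.1 h3
  rw [← himg s, ← himg sm, hz, image_image, image_image, ← hzx]
  apply image_congr
  intro y hy
  simp only [ι, Submodule.coe_add, Submodule.coe_smul]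
  rw [smul_add, smul_smul, hrd]
  module
end
end

section
/- Let n ≥ 2 and let P ⊂ ℝⁿ be a full-dimensional convex polytope. Then its section volume CDF G_P is absolutely continuous with respect to Lebesgue measure. -/
open MeasureTheory Set Pointwise
open scoped RealInnerProductSpace NNReal ENNReal

noncomputable section

open Classical in
/-- zero-one indicator of a proposition -/
def ind (p : Prop) : ℝ := if p then 1 else 0

lemma ind_true {p : Prop} (h : p) : ind p = 1 := by simp [ind, h]
lemma ind_false {p : Prop} (h : ¬ p) : ind p = 0 := by simp [ind, h]

lemma ind_int_lt (g : ℝ → ℝ) (e c : ℝ) :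
    ∫ z in e..c, g z * ind (e < z) = ind (e ≤ c) * ∫ z in e..c, g z := by
  by_cases h : e ≤ c
  · rw [ind_true h, one_mul]
    apply intervalIntegral.integral_congr_ae
    refine Filter.Eventually.of_forall fun z hz => ?_
    rw [uIoc_of_le h] at hz
    rw [ind_true hz.1, mul_one]
  · rw [ind_false h, zero_mul]
    rw [← intervalIntegral.integral_zero (a := e) (b := c) (μ := volume)]
    apply intervalIntegral.integral_congr_ae
    refine Filter.Eventually.of_forall fun z hz => ?_
    rw [uIoc_of_ge (not_le.1 h).le] at hz
    rw [ind_false (not_lt.2 hz.2), mul_zero]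

lemma ind_le_ae (e : ℝ) : ∀ᵐ z : ℝ, ind (e ≤ z) = ind (e < z) := by
  have : ∀ᵐ z : ℝ, z ≠ e := by
    simp [ae_iff]
  filter_upwards [this] with z hz
  by_cases h : e < z
  · rw [ind_true h, ind_true h.le]
  · rw [ind_false h, ind_false]
    intro h'
    exact h (lt_of_le_of_ne h' hz.symm)

lemma measurable_ind {s : Set ℝ} (hs : MeasurableSet s) : Measurable fun z => ind (z ∈ s) := by
  unfold ind
  exact Measurable.ite hs measurable_const measurable_const

lemma abs_ind_le (p : Prop) : |ind p| ≤ 1 := by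
  by_cases h : p
  · simp [ind_true h]
  · simp [ind_false h]

lemma ii_ind {g : ℝ → ℝ} (hg : ∀ a b, IntervalIntegrable g volume a b) {s : Set ℝ}
    (hs : MeasurableSet s) (a b : ℝ) :
    IntervalIntegrable (fun z => g z * ind (z ∈ s)) volume a b := by
  have h := hg a b
  rw [intervalIntegrable_iff] at h ⊢
  refine Integrable.mul_bdd (c := 1) h (measurable_ind hs).aestronglyMeasurable ?_
  exact Filter.Eventually.of_forall fun z => by simpa using abs_ind_le _

lemma ind_int_lt' {g : ℝ → ℝ} (hg : ∀ a b, IntervalIntegrable g volume a b) (e b c : ℝ) :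
    ∫ z in b..c, g z * ind (e < z) =
      ind (e ≤ c) * (∫ z in e..c, g z) - ind (e ≤ b) * ∫ z in e..b, g z := by
  have h := ii_ind hg (measurableSet_Ioi (a := e))
  simp only [mem_Ioi] at h
  rw [← ind_int_lt, ← ind_int_lt,
    intervalIntegral.integral_interval_sub_left (h _ _) (h _ _)]

section L1
variable {T : Type*}

def Good (R : Subalgebra ℝ (T → ℝ)) (L : Set (T → ℝ)) (f : T × ℝ → ℝ) : Prop :=
  (∀ t a b, IntervalIntegrable (fun z => f (t, z)) volume a b) ∧
  ∀ k : ℕ, ∀ b ∈ L, ∀ c ∈ L, (fun t => ∫ z in (b t)..(c t), z ^ k * f (t, z)) ∈ R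

variable {R : Subalgebra ℝ (T → ℝ)} {L : Set (T → ℝ)}

lemma Good.pow {f : T × ℝ → ℝ} (hf : Good R L f) (k : ℕ) (t : T) (a b : ℝ) :
    IntervalIntegrable (fun z => z ^ k * f (t, z)) volume a b :=
  (hf.1 t a b).continuousOn_mul (by fun_prop)

lemma Good.add {f g : T × ℝ → ℝ} (hf : Good R L f) (hg : Good R L g) : Good R L (f + g) := by
  refine ⟨fun t a b => (hf.1 t a b).add (hg.1 t a b), fun k b hb c hc => ?_⟩
  have := R.add_mem (hf.2 k b hb c hc) (hg.2 k b hb c hc)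
  convert this using 1
  funext t
  simp only [Pi.add_apply, mul_add]
  rw [intervalIntegral.integral_add (hf.pow k t _ _) (hg.pow k t _ _)]

lemma Good.mul_fst {f : T × ℝ → ℝ} (hf : Good R L f) {r : T → ℝ} (hr : r ∈ R) :
    Good R L (f * fun p => r p.1) := by
  refine ⟨fun t a b => (hf.1 t a b).mul_const (r t), fun k b hb c hc => ?_⟩
  have := R.mul_mem (hf.2 k b hb c hc) hr
  convert this using 1
  funext t
  simp only [Pi.mul_apply, ← mul_assoc]
  rw [intervalIntegral.integral_mul_const]

lemma Good.mul_snd {f : T × ℝ → ℝ} (hf : Good R L f) : Good R L (f * Prod.snd) := by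
  refine ⟨fun t a b => ?_, fun k b hb c hc => ?_⟩
  · simpa [mul_comm] using hf.pow 1 t a b
  · have := hf.2 (k+1) b hb c hc
    convert this using 1
    funext t
    simp only [Pi.mul_apply]
    congr 1; funext z; ring

lemma Good.mul_lt (hind : ∀ a ∈ L, ∀ b ∈ L, (fun t => ind (a t ≤ b t)) ∈ R)
    {f : T × ℝ → ℝ} (hf : Good R L f) {e : T → ℝ} (he : e ∈ L) :
    Good R L (f * fun p => ind (e p.1 < p.2)) := by
  refine ⟨fun t a b => ii_ind (hf.1 t) (measurableSet_Ioi (a := e t)) a b, fun k b hb c hc => ?_⟩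
  have := R.sub_mem (R.mul_mem (hind e he c hc) (hf.2 k e he c hc))
    (R.mul_mem (hind e he b hb) (hf.2 k e he b hb))
  convert this using 1
  funext t
  simp only [Pi.mul_apply, ← mul_assoc, Pi.sub_apply]
  rw [ind_int_lt' (hf.pow k t)]

lemma Good.mul_le (hind : ∀ a ∈ L, ∀ b ∈ L, (fun t => ind (a t ≤ b t)) ∈ R)
    {f : T × ℝ → ℝ} (hf : Good R L f) {e : T → ℝ} (he : e ∈ L) :
    Good R L (f * fun p => ind (e p.1 ≤ p.2)) := by
  refine ⟨fun t a b => ii_ind (hf.1 t) (measurableSet_Ici (a := e t)) a b, fun k b hb c hc => ?_⟩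
  have := (hf.mul_lt hind he).2 k b hb c hc
  convert this using 1
  funext t
  apply intervalIntegral.integral_congr_ae
  filter_upwards [ind_le_ae (e t)] with z hz _
  simp only [Pi.mul_apply, hz]

def intAlg (R : Subalgebra ℝ (T → ℝ)) (L : Set (T → ℝ)) : Subalgebra ℝ (T × ℝ → ℝ) where
  carrier := {g | ∀ f, Good R L f → Good R L (f * g)}
  mul_mem' := by
    intro a b ha hb f hf
    rw [← mul_assoc]
    exact hb _ (ha _ hf)
  add_mem' := by
    intro a b ha hb f hf
    rw [mul_add]
    exact (ha _ hf).add (hb _ hf)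
  algebraMap_mem' := by
    intro r f hf
    exact hf.mul_fst (R.algebraMap_mem r)

lemma good_one (hL : L ⊆ R) : Good R L 1 := by
  refine ⟨fun t a b => intervalIntegrable_const, fun k b hb c hc => ?_⟩
  have := R.smul_mem (R.sub_mem (R.pow_mem (hL hc) (k+1)) (R.pow_mem (hL hb) (k+1))) (1 / ((k:ℝ)+1))
  convert this using 1
  funext t
  simp [integral_pow]
  ring

lemma intAlg_integral (hL : L ⊆ R) {f : T × ℝ → ℝ} (hf : f ∈ intAlg R L) {b c : T → ℝ}
    (hb : b ∈ L) (hc : c ∈ L) : (fun t => ∫ z in (b t)..(c t), f (t, z)) ∈ R := by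
  have := (hf 1 (good_one hL)).2 0 b hb c hc
  simpa using this

lemma intAlg_fst {r : T → ℝ} (hr : r ∈ R) : (fun p : T × ℝ => r p.1) ∈ intAlg R L :=
  fun _ hf => hf.mul_fst hr

lemma intAlg_snd : (Prod.snd : T × ℝ → ℝ) ∈ intAlg R L := fun _ hf => hf.mul_snd

lemma intAlg_le (hind : ∀ a ∈ L, ∀ b ∈ L, (fun t => ind (a t ≤ b t)) ∈ R)
    {e : T → ℝ} (he : e ∈ L) : (fun p : T × ℝ => ind (e p.1 ≤ p.2)) ∈ intAlg R L :=
  fun _ hf => hf.mul_le hind he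

lemma intAlg_lt (hind : ∀ a ∈ L, ∀ b ∈ L, (fun t => ind (a t ≤ b t)) ∈ R)
    {e : T → ℝ} (he : e ∈ L) : (fun p : T × ℝ => ind (e p.1 < p.2)) ∈ intAlg R L :=
  fun _ hf => hf.mul_lt hind he

lemma intAlg_half (hind : ∀ a ∈ L, ∀ b ∈ L, (fun t => ind (a t ≤ b t)) ∈ R)
    {α β : T → ℝ} (h1 : (fun t => ind (0 < α t)) ∈ R) (h2 : (fun t => ind (α t < 0)) ∈ R)
    (h3 : (fun t => ind (α t = 0)) ∈ R) (h4 : (fun t => ind (0 ≤ β t)) ∈ R)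
    (h5 : (fun t => - β t / α t) ∈ L) :
    (fun p : T × ℝ => ind (0 ≤ α p.1 * p.2 + β p.1)) ∈ intAlg R L := by
  have A := (intAlg R L).mul_mem (intAlg_fst h1) (intAlg_le hind h5)
  have B := (intAlg R L).mul_mem (intAlg_fst h2)
    ((intAlg R L).sub_mem (intAlg R L).one_mem (intAlg_lt hind h5))
  have C := (intAlg R L).mul_mem (intAlg_fst (L := L) h3) (intAlg_fst h4)
  have := (intAlg R L).add_mem ((intAlg R L).add_mem A B) C
  convert this using 1
  funext p
  simp only [Pi.add_apply, Pi.mul_apply, Pi.sub_apply, Pi.one_apply]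
  rcases lt_trichotomy (α p.1) 0 with h | h | h
  · rw [ind_false h.not_gt, ind_true h, ind_false h.ne]
    have : (0 ≤ α p.1 * p.2 + β p.1) ↔ ¬ (- β p.1 / α p.1 < p.2) := by
      rw [not_lt, le_div_iff_of_neg h]
      constructor <;> intro _ <;> linarith
    by_cases h' : 0 ≤ α p.1 * p.2 + β p.1
    · rw [ind_true h', ind_false (this.1 h')]; ring
    · rw [ind_false h', ind_true (not_not.1 fun h'' => h' (this.2 h''))]; ring
  · rw [ind_false h.not_gt, ind_false h.not_lt, ind_true h, h]; simp
  · rw [ind_false h.not_gt, ind_true h, ind_false h.ne']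
    have : (0 ≤ α p.1 * p.2 + β p.1) ↔ (- β p.1 / α p.1 ≤ p.2) := by
      rw [div_le_iff₀ h]
      constructor <;> intro _ <;> linarith
    rw [this]; ring

end L1

section PPsec
variable (E : Type) [AddCommGroup E] [Module ℝ E]

def affs : Set (E → ℝ) := {f | ∃ l : E →ᵃ[ℝ] ℝ, f = l}

/-- piecewise polynomial functions -/
def PP : Subalgebra ℝ (E → ℝ) :=
  Algebra.adjoin ℝ (affs E ∪ {f | ∃ l ∈ affs E, f = fun x => ind (0 ≤ l x)})

variable {E}
lemma affs_sub : affs E ⊆ PP E := fun _ h => Algebra.subset_adjoin (Or.inl h)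

lemma PP_ind {l : E → ℝ} (h : l ∈ affs E) : (fun x => ind (0 ≤ l x)) ∈ PP E :=
  Algebra.subset_adjoin (Or.inr ⟨l, h, rfl⟩)

lemma PP_hind : ∀ a ∈ affs E, ∀ b ∈ affs E, (fun t => ind (a t ≤ b t)) ∈ PP E := by
  rintro _ ⟨a, rfl⟩ _ ⟨b, rfl⟩
  have := PP_ind (E := E) ⟨b - a, rfl⟩
  simpa using this

lemma PP_comp {E' : Type} [AddCommGroup E'] [Module ℝ E'] (φ : E →ᵃ[ℝ] E') {f : E' → ℝ}
    (hf : f ∈ PP E') : (fun x => f (φ x)) ∈ PP E := by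
  induction hf using Algebra.adjoin_induction with
  | mem x hx =>
    rcases hx with ⟨l, rfl⟩ | ⟨_, ⟨l, rfl⟩, rfl⟩
    · exact affs_sub ⟨l.comp φ, rfl⟩
    · exact PP_ind (l := fun x => l (φ x)) ⟨l.comp φ, rfl⟩
  | algebraMap r => exact (PP E).algebraMap_mem r
  | add f g _ _ hf hg => exact (PP E).add_mem hf hg
  | mul f g _ _ hf hg => exact (PP E).mul_mem hf hg

lemma affs_prod {l : E × ℝ →ᵃ[ℝ] ℝ} : ∃ (α : ℝ) (β : E →ᵃ[ℝ] ℝ), ∀ p, l p = α * p.2 + β p.1 := by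
  refine ⟨l.linear (0, 1), l.comp (LinearMap.inl ℝ E ℝ).toAffineMap, fun p => ?_⟩
  have : p = (p.2 • (0, 1) : E × ℝ) +ᵥ ((p.1, 0) : E × ℝ) := by ext <;> simp
  conv_lhs => rw [this, AffineMap.map_vadd, map_smul]
  simp [mul_comm]

lemma PP_sub_int : PP (E × ℝ) ≤ intAlg (PP E) (affs E) := by
  apply Algebra.adjoin_le
  rintro _ (⟨l, rfl⟩ | ⟨_, ⟨l, rfl⟩, rfl⟩)
  · obtain ⟨α, β, h⟩ := affs_prod (l := l)
    have := (intAlg (PP E) (affs E)).add_mem ((intAlg (PP E) (affs E)).smul_mem intAlg_snd α)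
      (intAlg_fst (affs_sub ⟨β, rfl⟩))
    have e : (l : E × ℝ → ℝ) = α • Prod.snd + fun p => β p.1 := by
      funext p; simp [h]
    rw [e]; exact this
  · obtain ⟨α, β, h⟩ := affs_prod (l := l)
    simp only [h]
    refine intAlg_half (α := fun _ => α) (β := β) PP_hind ?_ ?_ ?_ ?_ ?_
    · exact (PP E).algebraMap_mem (ind (0 < α))
    · exact (PP E).algebraMap_mem (ind (α < 0))
    · exact (PP E).algebraMap_mem (ind (α = 0))
    · exact PP_ind ⟨β, rfl⟩
    · refine ⟨(-α⁻¹) • β, ?_⟩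
      funext t; simp; ring

lemma PP_int {f : E × ℝ → ℝ} (hf : f ∈ PP (E × ℝ)) (a b : ℝ) :
    (fun v => ∫ z in a..b, f (v, z)) ∈ PP E :=
  intAlg_integral affs_sub (PP_sub_int hf) (b := fun _ => a) (c := fun _ => b)
    ⟨AffineMap.const ℝ E a, rfl⟩ ⟨AffineMap.const ℝ E b, rfl⟩

end PPsec


section PPset
variable {E : Type} [AddCommGroup E] [Module ℝ E]

def PPset (s : Set E) : Prop := (fun x => ind (x ∈ s)) ∈ PP E

lemma PPset.inter {s t : Set E} (hs : PPset s) (ht : PPset t) : PPset (s ∩ t) := by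
  have := (PP E).mul_mem hs ht
  unfold PPset
  convert this using 1
  funext x
  by_cases h1 : x ∈ s <;> by_cases h2 : x ∈ t <;> simp [ind, h1, h2]

lemma PPset.compl {s : Set E} (hs : PPset s) : PPset sᶜ := by
  have := (PP E).sub_mem (PP E).one_mem hs
  unfold PPset
  convert this using 1
  funext x
  by_cases h1 : x ∈ s <;> simp [ind, h1]

lemma PPset.union {s t : Set E} (hs : PPset s) (ht : PPset t) : PPset (s ∪ t) := by
  have := (hs.compl.inter ht.compl).compl
  rwa [← compl_union, compl_compl] at this

lemma PPset.univ : PPset (Set.univ : Set E) := by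
  have := (PP E).one_mem
  unfold PPset
  convert this using 1
  funext x
  simp [ind]

lemma PPset.biInter {ι : Type*} (F : Finset ι) (f : ι → Set E) (h : ∀ i ∈ F, PPset (f i)) :
    PPset (⋂ i ∈ F, f i) := by
  classical
  induction F using Finset.induction_on with
  | empty => simpa using PPset.univ
  | insert a s ha ih =>
    rw [Finset.set_biInter_insert]
    exact (h a (by simp)).inter (ih fun i hi => h i (by simp [hi]))

lemma PPset.biUnion {ι : Type*} (F : Finset ι) (f : ι → Set E) (h : ∀ i ∈ F, PPset (f i)) :
    PPset (⋃ i ∈ F, f i) := by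
  have := (PPset.biInter F (fun i => (f i)ᶜ) (fun i hi => (h i hi).compl)).compl
  simpa [compl_iInter] using this

lemma PPset.half (l : E →ᵃ[ℝ] ℝ) : PPset {x | 0 ≤ l x} := PP_ind ⟨l, rfl⟩

lemma PPset.eq (l : E →ᵃ[ℝ] ℝ) : PPset {x | l x = 0} := by
  have := (PPset.half l).inter (PPset.half (-l))
  convert this using 1
  ext x
  simp only [mem_ofPred_eq, mem_inter_iff, AffineMap.coe_neg, Pi.neg_apply]
  constructor
  · intro h; simp [h]
  · rintro ⟨h1, h2⟩; linarith

end PPset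

lemma PPset_simplex {E : Type} [NormedAddCommGroup E] [NormedSpace ℝ E] [FiniteDimensional ℝ E]
    (t : Finset E) (ht : AffineIndependent ℝ ((↑) : t → E)) :
    PPset (convexHull ℝ (t : Set E)) := by
  classical
  obtain ⟨u, htu, hu, hu'⟩ := exists_subset_affineIndependent_affineSpan_eq_top
    (s := (t : Set E)) ht
  have : Fintype u := (finite_set_of_fin_dim_affineIndependent ℝ hu).fintype
  let b : AffineBasis u ℝ E := ⟨((↑) : u → E), hu, by simpa using hu'⟩
  have key : convexHull ℝ (t : Set E) =
      ⋂ i ∈ (Finset.univ : Finset u),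
        (if (i : E) ∈ t then {x | 0 ≤ b.coord i x} else {x | b.coord i x = 0}) := by
    apply Subset.antisymm
    · apply convexHull_min
      · intro x hx
        simp only [mem_iInter]
        intro i _
        have hbx : x = b ⟨x, htu hx⟩ := rfl
        split_ifs with h
        · simp only [mem_ofPred_eq]
          rw [hbx, AffineBasis.coord_apply]
          split_ifs <;> norm_num
        · simp only [mem_ofPred_eq]
          rw [hbx, AffineBasis.coord_apply, if_neg]
          rintro rfl
          exact h hx
      · refine convex_iInter fun i => convex_iInter fun _ => ?_
        split_ifs with h
        · exact (convex_Ici (0:ℝ)).affine_preimage (b.coord i)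
        · exact (convex_singleton (0:ℝ)).affine_preimage (b.coord i)
    · intro x hx
      simp only [mem_iInter] at hx
      have hx0 : ∀ i : u, 0 ≤ b.coord i x := by
        intro i
        have := hx i (Finset.mem_univ _)
        split_ifs at this with h
        · exact this
        · exact (show b.coord i x = 0 from this).ge
      have hxz : ∀ i : u, (i : E) ∉ t → b.coord i x = 0 := by
        intro i h
        have := hx i (Finset.mem_univ _)
        rw [if_neg h] at this
        exact this
      have e1 : ∑ i, b.coord i x • b i = x := b.linear_combination_coord_eq_self x
      have e2 : ∑ i, b.coord i x = 1 := b.sum_coord_apply_eq_one x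
      rw [← e1]
      have e3 : ∑ i, b.coord i x • b i
          = ∑ i ∈ Finset.univ.filter (fun i : u => (i : E) ∈ t), b.coord i x • b i := by
        rw [Finset.sum_filter]
        refine Finset.sum_congr rfl fun i _ => ?_
        split_ifs with h
        · rfl
        · rw [hxz i h, zero_smul]
      have e4 : ∑ i, b.coord i x
          = ∑ i ∈ Finset.univ.filter (fun i : u => (i : E) ∈ t), b.coord i x := by
        rw [Finset.sum_filter]
        refine Finset.sum_congr rfl fun i _ => ?_
        split_ifs with h
        · rfl
        · rw [hxz i h]
      rw [e3]
      refine (convex_convexHull ℝ (t : Set E)).sum_mem (fun i _ => hx0 i) (e4 ▸ e2) ?_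
      intro i hi
      exact subset_convexHull ℝ _ (show (i : E) ∈ t by simpa using hi)
  rw [key]
  refine PPset.biInter _ _ fun i _ => ?_
  split_ifs
  · exact PPset.half _
  · exact PPset.eq _

lemma PPset_polytope {E : Type} [NormedAddCommGroup E] [NormedSpace ℝ E] [FiniteDimensional ℝ E]
    (V : Finset E) : PPset (convexHull ℝ (V : Set E)) := by
  classical
  have : convexHull ℝ (V : Set E) =
      ⋃ t ∈ V.powerset.filter (fun t : Finset E => AffineIndependent ℝ ((↑) : t → E)),
        convexHull ℝ (t : Set E) := by
    rw [convexHull_eq_union]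
    ext x
    simp
    tauto
  rw [this]
  refine PPset.biUnion _ _ fun t ht => PPset_simplex t ?_
  simpa using (Finset.mem_filter.1 ht).2

/-- box -/
def box (r : ℝ) (k : ℕ) : Set (Fin k → ℝ) := Set.pi univ fun _ => Ioc (-r) r

lemma box_meas (r : ℝ) (k : ℕ) : MeasurableSet (box r k) :=
  MeasurableSet.univ_pi fun _ => measurableSet_Ioc

lemma box_finite (r : ℝ) (k : ℕ) : volume (box r k) < ∞ := by
  unfold box
  rw [volume_pi_pi]
  exact ENNReal.prod_lt_top fun i _ => by simp

lemma box_fubini {r : ℝ} (hr : 0 ≤ r) (k : ℕ) (g : (Fin (k+1) → ℝ) → ℝ) (hg : Measurable g)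
    (hb : ∀ x, |g x| ≤ 1) :
    ∫ u in box r (k+1), g u = ∫ z in (-r)..r, ∫ w in box r k, g (Fin.cons z w) := by
  have mp := (volume_preserving_piFinSuccAbove (fun _ : Fin (k+1) => ℝ) 0).symm
  have hpre : (MeasurableEquiv.piFinSuccAbove (fun _ : Fin (k+1) => ℝ) 0).symm ⁻¹' (box r (k+1))
      = (Ioc (-r) r) ×ˢ box r k := by
    ext ⟨z, w⟩
    simp [box, Fin.forall_fin_succ, MeasurableEquiv.piFinSuccAbove, Fin.insertNthEquiv]
  rw [← mp.setIntegral_preimage_emb (MeasurableEquiv.measurableEmbedding _), hpre,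
    Measure.volume_eq_prod, setIntegral_prod, intervalIntegral.integral_of_le (by linarith)]
  · simp [MeasurableEquiv.piFinSuccAbove, Fin.insertNthEquiv]
  · apply Measure.integrableOn_of_bounded (M := 1)
    · rw [Measure.prod_prod]
      exact (ENNReal.mul_lt_top (by simp) (box_finite r k)).ne
    · exact (hg.comp (MeasurableEquiv.measurable _)).aestronglyMeasurable
    · exact Filter.Eventually.of_forall fun x => hb _

lemma measurable_cons (k : ℕ) (z : ℝ) : Measurable fun w : Fin k → ℝ => (Fin.cons z w : Fin (k+1) → ℝ) := by
  rw [measurable_pi_iff]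
  intro i
  refine Fin.cases ?_ (fun i => ?_) i
  · simp
  · simpa using measurable_pi_apply i

def consLin (E : Type) [AddCommGroup E] [Module ℝ E] (k : ℕ) :
    ((E × ℝ) × (Fin k → ℝ)) →ₗ[ℝ] (E × (Fin (k+1) → ℝ)) where
  toFun p := (p.1.1, Fin.cons p.1.2 p.2)
  map_add' p q := by
    ext i
    · simp
    · refine Fin.cases ?_ (fun i => ?_) i <;> simp
  map_smul' c p := by
    ext i
    · simp
    · refine Fin.cases ?_ (fun i => ?_) i <;> simp

lemma PP_box {r : ℝ} (hr : 0 ≤ r) (k : ℕ) : ∀ {E : Type} [AddCommGroup E] [Module ℝ E]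
    (f : E × (Fin k → ℝ) → ℝ), f ∈ PP (E × (Fin k → ℝ)) → (∀ v, Measurable fun w => f (v, w)) →
    (∀ x, |f x| ≤ 1) → (fun v => ∫ w in box r k, f (v, w)) ∈ PP E := by
  induction k with
  | zero =>
    intro E _ _ f hf _ _
    have := PP_comp (LinearMap.inl ℝ E (Fin 0 → ℝ)).toAffineMap hf
    convert this using 1
    funext v
    have : box r 0 = univ := by ext; simp [box]
    rw [this, setIntegral_univ, volume_pi, Measure.pi_of_empty, integral_dirac]
    simp
    congr 2
  | succ k ih =>
    intro E _ _ f hf hm hb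
    have h1 := PP_comp (consLin E k).toAffineMap hf
    have h2 := ih _ h1 (fun v => (hm v.1).comp (measurable_cons k v.2)) (fun x => hb _)
    have h3 := PP_int h2 (-r) r
    convert h3 using 1
    funext v
    rw [box_fubini hr k _ (hm v) (fun x => hb _)]
    rfl


section Germ
open Polynomial Filter Topology

structure GermFilter (l : Filter ℝ) : Prop where
  sign : ∀ p : ℝ[X], p ≠ 0 → (∀ᶠ t in l, 0 < p.eval t) ∨ (∀ᶠ t in l, p.eval t < 0)
  basis : ∀ s ∈ l, ∃ a b, Ioo a b ∈ l ∧ Ioo a b ⊆ s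

lemma germ_right (t₀ : ℝ) : GermFilter (𝓝[>] t₀) := by
  constructor
  · intro p hp
    obtain ⟨q, hq, hnd⟩ := p.exists_eq_pow_rootMultiplicity_mul_and_not_dvd hp t₀
    rw [dvd_iff_isRoot, IsRoot.def] at hnd
    have ht : ∀ᶠ t in 𝓝[>] t₀, 0 < t - t₀ := by
      filter_upwards [self_mem_nhdsWithin] with t ht using sub_pos.2 ht
    have hc : Tendsto (fun t => q.eval t) (𝓝[>] t₀) (𝓝 (q.eval t₀)) :=
      q.continuous.continuousAt.tendsto.mono_left nhdsWithin_le_nhds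
    rcases lt_or_gt_of_ne hnd with h | h
    · right
      filter_upwards [ht, hc.eventually_lt_const h] with t h1 h2
      rw [hq]
      simp only [eval_mul, eval_pow, eval_sub, eval_X, eval_C]
      exact mul_neg_of_pos_of_neg (pow_pos h1 _) h2
    · left
      filter_upwards [ht, hc.eventually_const_lt h] with t h1 h2
      rw [hq]
      simp only [eval_mul, eval_pow, eval_sub, eval_X, eval_C]
      exact mul_pos (pow_pos h1 _) h2
  · intro s hs
    obtain ⟨u, hu, hus⟩ := (mem_nhdsGT_iff_exists_Ioo_subset).1 hs
    exact ⟨t₀, u, Ioo_mem_nhdsGT hu, hus⟩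

lemma germ_left (t₀ : ℝ) : GermFilter (𝓝[<] t₀) := by
  constructor
  · intro p hp
    have hp' : p.comp (-X) ≠ 0 := by
      intro h
      apply hp
      have := congrArg (fun q : ℝ[X] => q.comp (-X)) h
      simpa [comp_assoc] using this
    have hT : Tendsto (fun t : ℝ => -t) (𝓝[<] t₀) (𝓝[>] (-t₀)) := tendsto_neg_nhdsLT
    rcases (germ_right (-t₀)).sign _ hp' with h | h
    · left
      filter_upwards [hT.eventually h] with t ht
      simpa using ht
    · right
      filter_upwards [hT.eventually h] with t ht
      simpa using ht
  · intro s hs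
    obtain ⟨u, hu, hus⟩ := (mem_nhdsLT_iff_exists_Ioo_subset).1 hs
    exact ⟨u, t₀, Ioo_mem_nhdsLT hu, hus⟩

variable {l : Filter ℝ}

lemma GermFilter.ne (hl : GermFilter l) {p : ℝ[X]} (hp : p ≠ 0) : ∀ᶠ t in l, p.eval t ≠ 0 := by
  rcases hl.sign p hp with h | h
  · exact h.mono fun t ht => ht.ne'
  · exact h.mono fun t ht => ht.ne

def IsRG (l : Filter ℝ) (f : ℝ → ℝ) : Prop :=
  ∃ p q : ℝ[X], q ≠ 0 ∧ ∀ᶠ t in l, f t = p.eval t / q.eval t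

def RG (hl : GermFilter l) : Subalgebra ℝ (ℝ → ℝ) where
  carrier := {f | IsRG l f}
  mul_mem' := by
    rintro a b ⟨p, q, hq, h⟩ ⟨p', q', hq', h'⟩
    refine ⟨p * p', q * q', mul_ne_zero hq hq', ?_⟩
    filter_upwards [h, h'] with t h h'
    simp [h, h', div_mul_div_comm]
  add_mem' := by
    rintro a b ⟨p, q, hq, h⟩ ⟨p', q', hq', h'⟩
    refine ⟨p * q' + q * p', q * q', mul_ne_zero hq hq', ?_⟩
    filter_upwards [h, h', hl.ne hq, hl.ne hq'] with t h h' h1 h2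
    simp [h, h', div_add_div _ _ h1 h2]
  algebraMap_mem' := by
    intro r
    exact ⟨C r, 1, one_ne_zero, by simp⟩

lemma RG_mem {hl : GermFilter l} {f : ℝ → ℝ} : f ∈ RG hl ↔ IsRG l f := Iff.rfl

lemma RG_poly (hl : GermFilter l) (p : ℝ[X]) : (fun t => p.eval t) ∈ RG hl :=
  ⟨p, 1, one_ne_zero, by simp⟩

lemma RG_div {hl : GermFilter l} {f g : ℝ → ℝ} (hf : f ∈ RG hl) (hg : g ∈ RG hl) :
    (fun t => f t / g t) ∈ RG hl := by
  obtain ⟨p, q, hq, h⟩ := hf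
  obtain ⟨p', q', hq', h'⟩ := hg
  by_cases hp : p' = 0
  · refine ⟨0, 1, one_ne_zero, ?_⟩
    filter_upwards [h'] with t ht
    simp [ht, hp]
  · refine ⟨p * q', q * p', mul_ne_zero hq hp, ?_⟩
    filter_upwards [h, h'] with t h h'
    simp [h, h', div_div_div_eq]

lemma RG_sign {hl : GermFilter l} {f : ℝ → ℝ} (hf : f ∈ RG hl) :
    (∀ᶠ t in l, f t = 0) ∨ (∀ᶠ t in l, 0 < f t) ∨ (∀ᶠ t in l, f t < 0) := by
  obtain ⟨p, q, hq, h⟩ := hf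
  by_cases hp : p = 0
  · left
    filter_upwards [h] with t ht
    simp [ht, hp]
  right
  rcases hl.sign p hp with h1 | h1 <;> rcases hl.sign q hq with h2 | h2
  · left; filter_upwards [h, h1, h2] with t h h1 h2; rw [h]; exact div_pos h1 h2
  · right; filter_upwards [h, h1, h2] with t h h1 h2; rw [h]; exact div_neg_of_pos_of_neg h1 h2
  · right; filter_upwards [h, h1, h2] with t h h1 h2; rw [h]; exact div_neg_of_neg_of_pos h1 h2
  · left; filter_upwards [h, h1, h2] with t h h1 h2; rw [h]; exact div_pos_of_neg_of_neg h1 h2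

lemma RG_const_ev {hl : GermFilter l} {f : ℝ → ℝ} {c : ℝ} (h : ∀ᶠ t in l, f t = c) :
    f ∈ RG hl := ⟨C c, 1, one_ne_zero, by simpa using h⟩

lemma RG_ind {hl : GermFilter l} {f : ℝ → ℝ} (hf : f ∈ RG hl) {p : ℝ → Prop}
    (h1 : p = (fun x => 0 < x) ∨ p = (fun x => x < 0) ∨ p = (fun x => x = 0) ∨ p = (fun x => 0 ≤ x)) :
    (fun t => ind (p (f t))) ∈ RG hl := by
  have key : (∀ᶠ t in l, p (f t)) ∨ (∀ᶠ t in l, ¬ p (f t)) := by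
    rcases RG_sign hf with h | h | h <;> rcases h1 with rfl | rfl | rfl | rfl <;>
    first
    | (left; filter_upwards [h] with t ht; first | exact ht | exact ht.le | exact ht.ge)
    | (right; filter_upwards [h] with t ht; simp [ht, ht.le, ht.ne, ht.ne'])
    | (right; filter_upwards [h] with t ht; simp [ht])
  rcases key with h | h
  · exact RG_const_ev (h.mono fun t ht => ind_true ht)
  · exact RG_const_ev (h.mono fun t ht => ind_false ht)

lemma RG_hind (hl : GermFilter l) : ∀ a ∈ (RG hl : Set (ℝ → ℝ)), ∀ b ∈ (RG hl : Set (ℝ → ℝ)),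
    (fun t => ind (a t ≤ b t)) ∈ RG hl := by
  intro a ha b hb
  have := RG_ind (hl := hl) ((RG hl).sub_mem hb ha) (p := fun x => 0 ≤ x) (by simp)
  simpa using this

lemma aff2 (L : ℝ × ℝ →ᵃ[ℝ] ℝ) : ∃ α β γ : ℝ, ∀ x w, L (x, w) = α * x + β * w + γ := by
  obtain ⟨β, m, h⟩ := affs_prod (l := L)
  refine ⟨m.linear 1, β, m 0, fun x w => ?_⟩
  have e : m x = x * m.linear 1 + m 0 := by
    have : x = (x • (1:ℝ)) +ᵥ (0:ℝ) := by simp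
    conv_lhs => rw [this, AffineMap.map_vadd, map_smul]
    simp only [smul_eq_mul, vadd_eq_add]
  rw [h]
  simp only [e]
  ring

/-- Radon transform of piecewise polynomial is germwise rational -/
lemma PP_radon (hl : GermFilter l) {h : ℝ × ℝ → ℝ} (hh : h ∈ PP (ℝ × ℝ)) (s r : ℝ) :
    (fun t => ∫ x in (-r)..r, h (x, s - t * x)) ∈ RG hl := by
  have key : (fun p : ℝ × ℝ => h (p.2, s - p.1 * p.2)) ∈ intAlg (RG hl) (RG hl : Set (ℝ → ℝ)) := by
    induction hh using Algebra.adjoin_induction with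
    | mem f hf =>
      rcases hf with ⟨L, rfl⟩ | ⟨_, ⟨L, rfl⟩, rfl⟩
      · obtain ⟨α, β, γ, e⟩ := aff2 L
        have h1 := RG_poly hl (C α - C β * X)
        have h2 := RG_poly hl (C (β * s + γ))
        have := (intAlg (RG hl) (RG hl : Set (ℝ → ℝ))).add_mem
          ((intAlg (RG hl) (RG hl : Set (ℝ → ℝ))).mul_mem (intAlg_fst h1) intAlg_snd) (intAlg_fst h2)
        convert this using 1
        funext p
        simp [e]; ring
      · obtain ⟨α, β, γ, e⟩ := aff2 L
        have h1 := RG_poly hl (C α - C β * X)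
        have h2 := RG_poly hl (C (β * s + γ))
        have := intAlg_half (R := RG hl) (L := (RG hl : Set (ℝ → ℝ))) (RG_hind hl)
          (RG_ind h1 (p := fun x => 0 < x) (by simp)) (RG_ind h1 (p := fun x => x < 0) (by simp))
          (RG_ind h1 (p := fun x => x = 0) (by simp)) (RG_ind h2 (p := fun x => 0 ≤ x) (by simp))
          (RG_div ((RG hl).neg_mem h2) h1)
        convert this using 1
        funext p
        simp only [e, eval_sub, eval_mul, eval_C, eval_X]
        ring_nf
    | algebraMap c => exact Subalgebra.algebraMap_mem _ c
    | add f g _ _ hf hg => exact Subalgebra.add_mem _ hf hg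
    | mul f g _ _ hf hg => exact Subalgebra.mul_mem _ hf hg
  exact intAlg_integral (R := RG hl) (L := (RG hl : Set (ℝ → ℝ))) subset_rfl key
    (b := fun _ => -r) (c := fun _ => r)
    ((RG hl).algebraMap_mem (-r)) ((RG hl).algebraMap_mem r)

lemma quad_irred {b : ℝ} (hb : 0 < b) : Irreducible (X ^ 2 + C b : ℝ[X]) := by
  apply irreducible_of_degree_le_three_of_not_isRoot
  · have : (X ^ 2 + C b : ℝ[X]).natDegree = 2 := by compute_degree!
    simp [this]
  · intro x hx
    simp at hx
    nlinarith [sq_nonneg x]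

lemma descent {b : ℝ} (hb : 0 < b) (d : ℕ) : ∀ (p r : ℝ[X]) (c : ℤ), p.natDegree + r.natDegree ≤ d →
    Odd c → p ≠ 0 → r ≠ 0 →
    C (c : ℝ) * (2 * X) * p * r + 2 * (X ^ 2 + C b) * (derivative p * r - p * derivative r) ≠ 0 := by
  induction d using Nat.strong_induction_on with
  | _ d ih =>
  intro p r c hd hc hp hr h
  set q : ℝ[X] := X ^ 2 + C b with hq
  have hprime : Prime q := (quad_irred hb).prime
  have hqd : q.natDegree = 2 := by rw [hq]; compute_degree!
  have hq' : derivative q = 2 * X := by simp [hq]; norm_num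
  have hc0 : (c : ℝ) ≠ 0 := by
    have : c ≠ 0 := by rintro rfl; simp at hc
    exact_mod_cast this
  have hdvd : q ∣ C ((c : ℝ) * 2) * X * (p * r) := by
    refine ⟨- (2 * (derivative p * r - p * derivative r)), ?_⟩
    rw [C_mul]
    have h2 : (C (2:ℝ) : ℝ[X]) = 2 := rfl
    rw [h2]
    linear_combination h
  have hlin : ¬ q ∣ C ((c : ℝ) * 2) * X := by
    intro hh
    have h1 := natDegree_le_of_dvd hh (mul_ne_zero (by simpa using hc0) X_ne_zero)
    have h2 : (C ((c : ℝ) * 2) * X : ℝ[X]).natDegree ≤ 1 := (natDegree_C_mul_le _ _).trans natDegree_X_le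
    omega
  rcases hprime.dvd_or_dvd hdvd with h' | h'
  · exact hlin h'
  rcases hprime.dvd_or_dvd h' with ⟨p1, rfl⟩ | ⟨r1, rfl⟩
  · have hp1 : p1 ≠ 0 := right_ne_zero_of_mul hp
    rw [natDegree_mul hprime.ne_zero hp1, hqd] at hd
    refine ih (p1.natDegree + r.natDegree) (by omega) p1 r (c + 2) le_rfl
      (by obtain ⟨m, rfl⟩ := hc; exact ⟨m + 1, by ring⟩) hp1 hr ?_
    apply mul_left_cancel₀ hprime.ne_zero
    rw [mul_zero, ← h, derivative_mul, hq']
    push_cast [C_add]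
    have h2 : (C (2:ℝ) : ℝ[X]) = 2 := rfl
    rw [h2]
    ring
  · have hp1 : r1 ≠ 0 := right_ne_zero_of_mul hr
    rw [natDegree_mul hprime.ne_zero hp1, hqd] at hd
    refine ih (p.natDegree + r1.natDegree) (by omega) p r1 (c - 2) le_rfl
      (by obtain ⟨m, rfl⟩ := hc; exact ⟨m - 1, by ring⟩) hp hp1 ?_
    apply mul_left_cancel₀ hprime.ne_zero
    rw [mul_zero, ← h, derivative_mul, hq']
    push_cast [C_sub]
    have h2 : (C (2:ℝ) : ℝ[X]) = 2 := rfl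
    rw [h2]
    ring

lemma null_preimage_of_deriv {f f' : ℝ → ℝ} {a b : ℝ} (hm : Measurable f) (hm' : Measurable f')
    (hd : ∀ x ∈ Ioo a b, HasDerivAt f (f' x) x)
    (hs : (∀ x ∈ Ioo a b, 0 < f' x) ∨ (∀ x ∈ Ioo a b, f' x < 0))
    {N : Set ℝ} (hN : MeasurableSet N) (hN0 : volume N = 0) :
    volume (Ioo a b ∩ f ⁻¹' N) = 0 := by
  have hcont : ContinuousOn f (Ioo a b) := fun x hx => (hd x hx).continuousAt.continuousWithinAt
  have hinj : InjOn f (Ioo a b) := by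
    rcases hs with hs | hs
    · refine (strictMonoOn_of_deriv_pos (convex_Ioo a b) hcont ?_).injOn
      intro x hx
      rw [interior_Ioo] at hx
      rw [(hd x hx).deriv]; exact hs x hx
    · refine (strictAntiOn_of_deriv_neg (convex_Ioo a b) hcont ?_).injOn
      intro x hx
      rw [interior_Ioo] at hx
      rw [(hd x hx).deriv]; exact hs x hx
  set S := Ioo a b ∩ f ⁻¹' N
  have hS : MeasurableSet S := measurableSet_Ioo.inter (hm hN)
  have e := lintegral_image_eq_lintegral_abs_deriv_mul (f' := f') hS
    (fun x hx => (hd x hx.1).hasDerivWithinAt) (hinj.mono inter_subset_left) (fun _ => 1)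
  have h0 : volume (f '' S) = 0 := measure_mono_null (by rintro _ ⟨x, hx, rfl⟩; exact hx.2) hN0
  simp only [lintegral_one, Measure.restrict_apply_univ, h0, mul_one] at e
  have e' := (setLIntegral_eq_zero_iff hS (f := fun x => ENNReal.ofReal |f' x|)
    (by fun_prop)).1 e.symm
  rw [← Measure.restrict_apply_univ]
  rw [← nonpos_iff_eq_zero]
  have : ∀ᵐ x, x ∉ S := by
    filter_upwards [e'] with x hx hxS
    have h1 := hx hxS
    simp only [ENNReal.ofReal_eq_zero] at h1
    have h2 : f' x = 0 := abs_eq_zero.1 (le_antisymm h1 (abs_nonneg _))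
    rcases hs with hs | hs
    · exact (hs x hxS.1).ne' h2
    · exact (hs x hxS.1).ne h2
  rw [Measure.restrict_apply_univ]
  rw [ae_iff] at this
  simpa using this.le

lemma rg_null (hl : GermFilter l) {A : ℝ → ℝ} (hA : A ∈ RG hl) {K b : ℝ} (hK : 0 < K) (hb : 0 < b)
    {N : Set ℝ} (hN0 : volume N = 0) :
    ∃ U ∈ l, volume (U ∩ {t | A t ≠ 0 ∧ K * (t ^ 2 + b) * A t ^ 2 ∈ N}) = 0 := by
  obtain ⟨p, r, hr, h⟩ := hA
  by_cases hp : p = 0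
  · refine ⟨_, h, ?_⟩
    convert measure_empty (μ := (volume : Measure ℝ))
    ext t
    simp [hp]
    tauto
  set q : ℝ[X] := X ^ 2 + C b with hq
  set P1 : ℝ[X] := C K * q * p ^ 2 with hP1
  set Q1 : ℝ[X] := r ^ 2 with hQ1
  set D : ℝ[X] := derivative P1 * Q1 - P1 * derivative Q1 with hD
  have hq' : derivative q = 2 * X := by simp [hq]; norm_num
  have hD0 : D ≠ 0 := by
    intro h0
    apply descent hb _ p r 1 le_rfl (by norm_num) hp hr
    have e : D = C K * p * r * (C ((1 : ℤ) : ℝ) * (2 * X) * p * r +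
        2 * (X ^ 2 + C b) * (derivative p * r - p * derivative r)) := by
      rw [hD, hP1, hQ1]
      simp only [derivative_mul, derivative_C, derivative_pow, hq']
      simp
      have h2 : (C (2:ℝ) : ℝ[X]) = 2 := rfl
      rw [h2, hq]
      ring
    rw [e] at h0
    rcases mul_eq_zero.1 h0 with h1 | h1
    · exact absurd h1 (mul_ne_zero (mul_ne_zero (by simpa using hK.ne') hp) hr)
    · exact h1
  have hQ0 : Q1 ≠ 0 := pow_ne_zero _ hr
  have hsD := hl.sign D hD0
  have hev : ∀ᶠ t in l, A t = p.eval t / r.eval t ∧ Q1.eval t ≠ 0 := h.and (hl.ne hQ0)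
  have fin : ∀ a c : ℝ, (∀ t ∈ Ioo a c, A t = p.eval t / r.eval t ∧ Q1.eval t ≠ 0) →
      ((∀ t ∈ Ioo a c, 0 < D.eval t) ∨ (∀ t ∈ Ioo a c, D.eval t < 0)) →
      volume (Ioo a c ∩ {t | A t ≠ 0 ∧ K * (t ^ 2 + b) * A t ^ 2 ∈ N}) = 0 := by
    intro a c h1 h2
    have := null_preimage_of_deriv (f := fun t => P1.eval t / Q1.eval t)
      (f' := fun t => D.eval t / (Q1.eval t) ^ 2) (a := a) (b := c)
      (by fun_prop) (by fun_prop) ?_ ?_ (measurableSet_toMeasurable volume N)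
      (by rw [measure_toMeasurable, hN0])
    · refine measure_mono_null ?_ this
      rintro t ⟨ht, -, htN⟩
      refine ⟨ht, subset_toMeasurable _ _ ?_⟩
      convert htN using 1
      rw [(h1 t ht).1, hP1, hQ1]
      simp [hq]
      ring
    · intro x hx
      have := (P1.hasDerivAt x).div (Q1.hasDerivAt x) (h1 x hx).2
      have e : D.eval x / (Q1.eval x) ^ 2 = ((derivative P1).eval x * Q1.eval x
          - P1.eval x * (derivative Q1).eval x) / (Q1.eval x) ^ 2 := by
        rw [hD, eval_sub, eval_mul, eval_mul]
      rw [e]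
      exact this
    · rcases h2 with h2 | h2
      · left; intro x hx
        have := (h1 x hx).2
        exact div_pos (h2 x hx) (by positivity)
      · right; intro x hx
        have := (h1 x hx).2
        exact div_neg_of_neg_of_pos (h2 x hx) (by positivity)
  rcases hsD with hsD | hsD
  · obtain ⟨a, c, hac, hs⟩ := hl.basis _ (hev.and hsD)
    exact ⟨_, hac, fin a c (fun t ht => (hs ht).1) (Or.inl fun t ht => (hs ht).2)⟩
  · obtain ⟨a, c, hac, hs⟩ := hl.basis _ (hev.and hsD)
    exact ⟨_, hac, fin a c (fun t ht => (hs ht).1) (Or.inr fun t ht => (hs ht).2)⟩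

lemma line_null {A : ℝ → ℝ} (hA : ∀ l, ∀ hl : GermFilter l, A ∈ RG hl) {K b : ℝ} (hK : 0 < K)
    (hb : 0 < b) {N : Set ℝ} (hN0 : volume N = 0) :
    volume {t | A t ≠ 0 ∧ K * (t ^ 2 + b) * A t ^ 2 ∈ N} = 0 := by
  apply measure_null_of_locally_null
  intro t₀ _
  obtain ⟨U, hU, hU0⟩ := rg_null (germ_right t₀) (hA _ _) hK hb hN0
  obtain ⟨V, hV, hV0⟩ := rg_null (germ_left t₀) (hA _ _) hK hb hN0
  set B := {t | A t ≠ 0 ∧ K * (t ^ 2 + b) * A t ^ 2 ∈ N}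
  refine ⟨((U ∪ V) ∪ {t₀}) ∩ B, ?_, ?_⟩
  · refine inter_mem (nhdsWithin_le_nhds ?_) self_mem_nhdsWithin
    rw [← nhdsNE_sup_pure, ← nhdsLT_sup_nhdsGT]
    refine mem_sup.2 ⟨mem_sup.2 ⟨mem_of_superset hV ?_, mem_of_superset hU ?_⟩, ?_⟩
    · intro x hx; simp [hx]
    · intro x hx; simp [hx]
    · simp
  · rw [union_inter_distrib_right, union_inter_distrib_right]
    refine measure_union_null (measure_union_null hU0 hV0) ?_
    exact measure_mono_null inter_subset_left (by simp)

end Germ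


def pt {k : ℕ} (u : Fin (k+1) → ℝ) (x : ℝ) : Euc (k+2) := WithLp.toLp 2 (Fin.snoc u x : Fin (k+2) → ℝ)

lemma pt_cast {k : ℕ} (u : Fin (k+1) → ℝ) (x : ℝ) (i : Fin (k+1)) : pt u x i.castSucc = u i := by
  simp [pt]

lemma pt_last {k : ℕ} (u : Fin (k+1) → ℝ) (x : ℝ) : pt u x (Fin.last (k+1)) = x := by
  simp [pt]

lemma pt_measurable {k : ℕ} : Measurable fun p : (Fin (k+1) → ℝ) × ℝ => pt p.1 p.2 := by
  unfold pt
  refine (WithLp.measurable_toLp 2 _).comp ?_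
  rw [measurable_pi_iff]
  intro i
  refine Fin.lastCases ?_ (fun i => ?_) i
  · simpa using measurable_snd
  · simp only [Fin.snoc_castSucc]
    exact (measurable_pi_apply i).comp measurable_fst

lemma euc_ext {k : ℕ} {x y : Euc (k+2)} (h1 : ∀ i : Fin (k+1), x i.castSucc = y i.castSucc)
    (h2 : x (Fin.last (k+1)) = y (Fin.last (k+1))) : x = y := by
  ext i
  refine Fin.lastCases h2 h1 i

def slice {k : ℕ} (P : Set (Euc (k+2))) (θ : Euc (k+2)) (s : ℝ) : Set (Fin (k+1) → ℝ) :=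
  {u | pt u ((s - ∑ i : Fin (k+1), θ i.castSucc * u i) / θ (Fin.last (k+1))) ∈ P}

def Sl {k : ℕ} (P : Set (Euc (k+2))) (θ : Euc (k+2)) (s : ℝ) : ℝ := (volume (slice P θ s)).toReal

lemma slice_joint {k : ℕ} {P : Set (Euc (k+2))} (hP : MeasurableSet P) :
    MeasurableSet {p : (Euc (k+2) × ℝ) × (Fin (k+1) → ℝ) | p.2 ∈ slice P p.1.1 p.1.2} := by
  have : Measurable fun p : (Euc (k+2) × ℝ) × (Fin (k+1) → ℝ) =>
      pt p.2 ((p.1.2 - ∑ i : Fin (k+1), p.1.1 i.castSucc * p.2 i) / p.1.1 (Fin.last (k+1))) := by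
    refine pt_measurable.comp (Measurable.prodMk measurable_snd ?_)
    refine Measurable.div (Measurable.sub (by fun_prop) ?_) (by fun_prop)
    refine Finset.measurable_sum _ fun i _ => ?_
    fun_prop
  exact this hP

lemma Sl_measurable {k : ℕ} {P : Set (Euc (k+2))} (hP : MeasurableSet P) :
    Measurable fun p : Euc (k+2) × ℝ => Sl P p.1 p.2 :=
  (measurable_measure_prodMk_left (slice_joint hP)).ennreal_toReal

lemma slice_meas {k : ℕ} {P : Set (Euc (k+2))} (hP : MeasurableSet P) (θ : Euc (k+2)) (s : ℝ) :
    MeasurableSet (slice P θ s) := measurable_prodMk_left (x := (θ, s)) (slice_joint hP)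

lemma slice_box {k : ℕ} {P : Set (Euc (k+2))} {r : ℝ} (hr : ∀ x ∈ P, ‖x‖ < r) (θ : Euc (k+2)) (s : ℝ) :
    slice P θ s ⊆ box r (k+1) := by
  intro u hu i _
  have h1 := hr _ hu
  have h2 := EuclideanSpace.norm_eq (pt u ((s - ∑ i : Fin (k+1), θ i.castSucc * u i) / θ (Fin.last (k+1))))
  have h3 := PiLp.norm_apply_le (pt u ((s - ∑ i : Fin (k+1), θ i.castSucc * u i) / θ (Fin.last (k+1)))) i.castSucc
  rw [pt_cast, Real.norm_eq_abs] at h3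
  have := abs_lt.1 (h3.trans_lt h1)
  exact ⟨this.1, this.2.le⟩

lemma slice_finite {k : ℕ} {P : Set (Euc (k+2))} (hP : Bornology.IsBounded P) (θ : Euc (k+2)) (s : ℝ) :
    volume (slice P θ s) < ∞ := by
  obtain ⟨r, hr, h⟩ := hP.exists_pos_norm_lt
  exact (measure_mono (slice_box h θ s)).trans_lt (box_finite _ _)

def phi {k : ℕ} (y : Fin k → ℝ) : ((ℝ × ℝ) × (Fin k → ℝ)) →ₗ[ℝ] Euc (k+2) where
  toFun p := pt (Fin.cons p.1.1 p.2) (p.1.2 - ∑ i, y i * p.2 i)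
  map_add' p q := by
    apply euc_ext
    · intro i
      simp only [PiLp.add_apply, pt_cast]
      refine Fin.cases ?_ (fun i => ?_) i <;> simp
    · simp only [PiLp.add_apply, pt_last]
      simp [mul_add, Finset.sum_add_distrib]; ring
  map_smul' c p := by
    apply euc_ext
    · intro i
      simp only [PiLp.smul_apply, pt_cast]
      refine Fin.cases ?_ (fun i => ?_) i <;> simp
    · simp only [PiLp.smul_apply, pt_last]
      simp [mul_sub, Finset.mul_sum]
      refine Finset.sum_congr rfl fun i _ => by ring

lemma measurable_ind' {X : Type*} [MeasurableSpace X] {s : Set X} (hs : MeasurableSet s) :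
    Measurable fun z => ind (z ∈ s) := by
  unfold ind
  exact Measurable.ite hs measurable_const measurable_const

lemma Sl_RG {k : ℕ} (V : Finset (Euc (k+2))) (y : Fin k → ℝ) (s : ℝ) {l : Filter ℝ} (hl : GermFilter l) :
    (fun t => Sl (convexHull ℝ (V : Set (Euc (k+2)))) (pt (Fin.cons t y) 1) s) ∈ RG hl := by
  set P := convexHull ℝ (V : Set (Euc (k+2))) with hP
  have hPc : IsCompact P := V.finite_toSet.isCompact_convexHull ℝ
  obtain ⟨r, hr0, hr⟩ := hPc.isBounded.exists_pos_norm_lt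
  have hPm : MeasurableSet P := hPc.isClosed.measurableSet
  have hf := PP_comp (phi y).toAffineMap (PPset_polytope V)
  have h1 := PP_box hr0.le k _ hf ?_ (fun x => abs_ind_le _)
  · have h2 := PP_radon hl h1 s r
    convert h2 using 1
    funext t
    have hb := slice_box hr (pt (Fin.cons t y) 1) s
    have hm := slice_meas hPm (pt (Fin.cons t y) 1) s
    have e1 : Sl P (pt (Fin.cons t y) 1) s
        = ∫ u in box r (k+1), ind (u ∈ slice P (pt (Fin.cons t y) 1) s) := by
      have : (fun u => ind (u ∈ slice P (pt (Fin.cons t y) 1) s))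
          = (slice P (pt (Fin.cons t y) 1) s).indicator (fun _ => (1:ℝ)) := by
        funext u
        by_cases h : u ∈ slice P (pt (Fin.cons t y) 1) s <;> simp [ind, h]
      rw [this, setIntegral_indicator hm, inter_eq_right.2 hb]
      simp [Sl, Measure.real]
    rw [e1, box_fubini hr0.le k _ (measurable_ind' hm) (fun x => abs_ind_le _)]
    congr 1
    funext x
    congr 1
    funext w
    congr 1
    simp only [slice, pt_last, pt_cast, Fin.sum_univ_succ, phi]
    simp [sub_sub]
    rfl
  · intro v
    apply measurable_ind' (s := {w | pt (Fin.cons v.1 w) (v.2 - ∑ i, y i * w i) ∈ P})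
    have : Measurable fun w : Fin k → ℝ => pt (Fin.cons v.1 w) (v.2 - ∑ i, y i * w i) := by
      refine pt_measurable.comp (Measurable.prodMk (measurable_cons k v.1) ?_)
      refine Measurable.sub (by fun_prop) (Finset.measurable_sum _ fun i _ => ?_)
      fun_prop
    exact this hPm

def Fv {k : ℕ} (c : ℝ) (P : Set (Euc (k+2))) (θ : Euc (k+2)) (s : ℝ) : ℝ :=
  c * (‖θ‖ / |θ (Fin.last (k+1))|) * Sl P θ s

lemma Fv_measurable {k : ℕ} (c : ℝ) {P : Set (Euc (k+2))} (hP : MeasurableSet P) :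
    Measurable fun p : Euc (k+2) × ℝ => Fv c P p.1 p.2 := by
  unfold Fv
  refine Measurable.mul ?_ (Sl_measurable hP)
  refine measurable_const.mul (Measurable.div (by fun_prop) ?_)
  exact Measurable.abs (by fun_prop)

lemma pt_norm_sq {k : ℕ} (u : Fin (k+1) → ℝ) (x : ℝ) : ‖pt u x‖ ^ 2 = ∑ i, u i ^ 2 + x ^ 2 := by
  rw [EuclideanSpace.norm_sq_eq, Fin.sum_univ_castSucc]
  simp [pt_cast, pt_last]

lemma sq_null {N : Set ℝ} (hN : volume N = 0) : volume ((fun x : ℝ => x ^ 2) '' N) = 0 :=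
  addHaar_image_eq_zero_of_differentiableOn_of_addHaar_eq_zero volume (by fun_prop) hN

lemma line_null' {k : ℕ} {c : ℝ} (hc : 0 < c) (V : Finset (Euc (k+2))) (y : Fin k → ℝ) (s : ℝ)
    {N : Set ℝ} (hN : volume N = 0) :
    volume {t : ℝ | 0 < Fv c (convexHull ℝ (V : Set (Euc (k+2)))) (pt (Fin.cons t y) 1) s ∧
      Fv c (convexHull ℝ (V : Set (Euc (k+2)))) (pt (Fin.cons t y) 1) s ∈ N} = 0 := by
  have hb : 0 < ∑ i, y i ^ 2 + 1 := by positivity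
  refine measure_mono_null ?_ (line_null (fun l hl => Sl_RG V y s hl) (K := c ^ 2) (by positivity) hb
    (sq_null hN))
  rintro t ⟨h1, h2⟩
  refine ⟨?_, _, h2, ?_⟩
  · intro h
    rw [Fv, h] at h1
    simp at h1
  · simp only [Fv, mul_pow, pt_last, div_pow, pt_norm_sq, Fin.sum_univ_succ]
    simp
    exact Or.inl (Or.inl (by ring))

lemma pt_aux1 {k : ℕ} : Measurable fun p : (Fin (k+1) → ℝ) × ℝ => (p.1, (1:ℝ)) :=
    measurable_fst.prodMk measurable_const
lemma pt_aux2 {k : ℕ} : Measurable fun p : (Fin (k+1) → ℝ) × ℝ => pt p.1 1 := pt_measurable.comp pt_aux1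
lemma pt_aux3 {k : ℕ} : Measurable fun p : (Fin (k+1) → ℝ) × ℝ => (pt p.1 1, p.2) := pt_aux2.prodMk measurable_snd
lemma Fv1_measurable {k : ℕ} (c : ℝ) {P : Set (Euc (k+2))} (hP : MeasurableSet P) :
    Measurable fun p : (Fin (k+1) → ℝ) × ℝ => Fv c P (pt p.1 1) p.2 := by
  have := Measurable.comp (Fv_measurable c hP) pt_aux3
  simpa only [Function.comp_def] using this

lemma y_null {k : ℕ} {c : ℝ} (hc : 0 < c) (V : Finset (Euc (k+2)))
    {N : Set ℝ} (hNm : MeasurableSet N) (hN : volume N = 0) :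
    ∀ᵐ y : Fin (k+1) → ℝ,
    volume {s : ℝ | 0 < Fv c (convexHull ℝ (V : Set (Euc (k+2)))) (pt y 1) s ∧
      Fv c (convexHull ℝ (V : Set (Euc (k+2)))) (pt y 1) s ∈ N} = 0 := by
  set P := convexHull ℝ (V : Set (Euc (k+2))) with hP
  have hPc : IsCompact P := V.finite_toSet.isCompact_convexHull ℝ
  have hPm : MeasurableSet P := hPc.isClosed.measurableSet
  set S : Set ((Fin (k+1) → ℝ) × ℝ) := {p | 0 < Fv c P (pt p.1 1) p.2 ∧ Fv c P (pt p.1 1) p.2 ∈ N}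
  have hS : MeasurableSet S := by
    have := Fv1_measurable c hPm
    exact (measurableSet_lt measurable_const this).inter (this hNm)
  have h0 : (volume.prod volume) S = 0 := by
    rw [Measure.prod_apply_symm hS]
    refine lintegral_eq_zero_of_ae_eq_zero (Filter.Eventually.of_forall fun s => ?_)
    have hSs : MeasurableSet ((fun y => (y, s)) ⁻¹' S) := measurable_prodMk_right hS
    have mp := (volume_preserving_piFinSuccAbove (fun _ : Fin (k+1) => ℝ) 0).symm
    show volume ((fun y => (y, s)) ⁻¹' S) = 0
    rw [← mp.measure_preimage hSs.nullMeasurableSet]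
    rw [Measure.volume_eq_prod, Measure.prod_apply_symm (mp.measurable hSs)]
    refine lintegral_eq_zero_of_ae_eq_zero (Filter.Eventually.of_forall fun y => ?_)
    convert line_null' hc V y s hN using 2
    ext t
    simp [S, MeasurableEquiv.piFinSuccAbove, Fin.insertNthEquiv]
    rfl
    rfl
  exact Measure.measure_ae_null_of_prod_null h0


def pL {k : ℕ} (θ : Euc (k+2)) : Euc (k+1) →ₗ[ℝ] Euc (k+2) where
  toFun u := pt u (- (∑ i : Fin (k+1), θ i.castSucc * u i) / θ (Fin.last (k+1)))
  map_add' u v := by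
    apply euc_ext
    · intro i
      simp only [PiLp.add_apply, pt_cast]
    · simp only [PiLp.add_apply, pt_last, mul_add, Finset.sum_add_distrib]
      ring
  map_smul' c u := by
    apply euc_ext
    · intro i
      simp only [PiLp.smul_apply, pt_cast, RingHom.id_apply]
    · simp only [PiLp.smul_apply, pt_last, RingHom.id_apply, smul_eq_mul]
      have : ∑ i : Fin (k+1), θ i.castSucc * (c * u i) = c * ∑ i : Fin (k+1), θ i.castSucc * u i := by
        rw [Finset.mul_sum]
        refine Finset.sum_congr rfl fun i _ => by ring
      rw [this]; ring

lemma inner_split {k : ℕ} (x y : Euc (k+2)) : ⟪x, y⟫ = ∑ i : Fin (k+1), x i.castSucc * y i.castSucc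
    + x (Fin.last (k+1)) * y (Fin.last (k+1)) := by
  rw [PiLp.inner_apply, Fin.sum_univ_castSucc]
  simp [mul_comm]

lemma norm_split {k : ℕ} (x : Euc (k+2)) : ‖x‖ ^ 2 = ∑ i : Fin (k+1), x i.castSucc ^ 2
    + x (Fin.last (k+1)) ^ 2 := by
  rw [EuclideanSpace.norm_sq_eq, Fin.sum_univ_castSucc]
  simp

lemma pL_normDet {k : ℕ} (θ : Euc (k+2)) (h : θ (Fin.last (k+1)) ≠ 0) :
    (pL θ).normDet = ‖θ‖ / |θ (Fin.last (k+1))| := by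
  have h1 := (pL θ).normDet_sq_eq_det_gram (EuclideanSpace.basisFun (Fin (k+1)) ℝ)
  set v : Fin (k+1) → ℝ := fun i => - θ i.castSucc / θ (Fin.last (k+1)) with hv
  have h2 : (Matrix.gram ℝ (pL θ <| EuclideanSpace.basisFun (Fin (k+1)) ℝ ·))
      = 1 + Matrix.replicateCol Unit v * Matrix.replicateRow Unit v := by
    ext i j
    rw [Matrix.gram_apply, inner_split]
    simp only [pL, LinearMap.coe_mk, AddHom.coe_mk, pt_cast, pt_last, EuclideanSpace.basisFun_apply,
      PiLp.single_apply]
    simp [Matrix.mul_apply, Matrix.one_apply, hv, eq_comm]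
  rw [h2, Matrix.det_one_add_replicateCol_mul_replicateRow] at h1
  have h3 : (‖θ‖ / |θ (Fin.last (k+1))|) ^ 2 = 1 + v ⬝ᵥ v := by
    rw [div_pow, sq_abs, norm_split, add_div, div_self (by positivity), add_comm, Finset.sum_div]
    simp only [dotProduct, hv]
    congr 1
    refine Finset.sum_congr rfl fun i _ => by ring
  refine (pow_left_inj₀ (LinearMap.normDet_nonneg _) (by positivity) two_ne_zero).1 ?_
  rw [h3, ← h1]; simp

lemma section_eq {k : ℕ} (P : Set (Euc (k+2))) (θ : Euc (k+2)) (s : ℝ) (h : θ (Fin.last (k+1)) ≠ 0) :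
    P ∩ hyperplane θ s = (fun x => x + pt 0 (s / θ (Fin.last (k+1)))) ''
      (pL θ '' (WithLp.toLp 2 '' slice P θ s)) := by
  have key : ∀ u : Fin (k+1) → ℝ, pL θ (WithLp.toLp 2 u) + pt 0 (s / θ (Fin.last (k+1)))
      = pt u ((s - ∑ i : Fin (k+1), θ i.castSucc * u i) / θ (Fin.last (k+1))) := by
    intro u
    apply euc_ext
    · intro i
      simp [pL, pt_cast]
    · simp [pL, pt_last]
      ring
  ext x
  simp only [mem_image, exists_exists_and_eq_and, key]
  constructor
  · rintro ⟨hx, hs⟩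
    have : pt (fun i => x i.castSucc) ((s - ∑ i : Fin (k+1), θ i.castSucc * x i.castSucc)
        / θ (Fin.last (k+1))) = x := by
      apply euc_ext
      · intro i; simp [pt_cast]
      · rw [pt_last]
        have : ⟪x, θ⟫ = s := hs
        rw [inner_split] at this
        rw [← this]
        field_simp
        simp [mul_comm]
    refine ⟨fun i => x i.castSucc, ?_, this⟩
    show pt _ _ ∈ P
    rwa [this]
  · rintro ⟨u, hu, rfl⟩
    refine ⟨hu, ?_⟩
    show ⟪_, _⟫ = s
    rw [inner_split]
    simp only [pt_cast, pt_last]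
    field_simp
    simp [mul_comm]

lemma hausdorff_const (k : ℕ) : ∃ c : ℝ≥0, c ≠ 0 ∧
    (μH[((k+1 : ℕ) : ℝ)] : Measure (Euc (k+1))) = c • volume := by
  refine ⟨Measure.addHaarScalarFactor (μH[((k+1 : ℕ) : ℝ)] : Measure (Euc (k+1))) volume, ?_, 
    Measure.isAddLeftInvariant_eq_smul _ _⟩
  exact (Measure.addHaarScalarFactor_pos_of_isAddHaarMeasure _ _).ne'

def hc (k : ℕ) : ℝ≥0 := (hausdorff_const k).choose
lemma hc_ne (k : ℕ) : hc k ≠ 0 := (hausdorff_const k).choose_spec.1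
lemma hc_spec (k : ℕ) : (μH[((k+1 : ℕ) : ℝ)] : Measure (Euc (k+1))) = hc k • volume :=
  (hausdorff_const k).choose_spec.2

lemma dim_eq (k : ℕ) : (((k + 2 : ℕ) : ℝ) - 1) = ((k+1 : ℕ) : ℝ) := by push_cast; ring

lemma section_measure {k : ℕ} {P : Set (Euc (k+2))} (hP : MeasurableSet P)
    (θ : Euc (k+2)) (s : ℝ) (h : θ (Fin.last (k+1)) ≠ 0) :
    sectionVolume P θ s = Fv (hc k) P θ s := by
  unfold sectionVolume Fv Sl
  have hiso : Isometry (fun x : Euc (k+2) => x + pt 0 (s / θ (Fin.last (k+1)))) :=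
    isometry_add_right _
  have hf : ((Module.finrank ℝ (Euc (k+1)) : ℕ) : ℝ) = ((k+1 : ℕ) : ℝ) := by simp
  have h1 := (pL θ).hausdorffMeasure_image (WithLp.toLp 2 '' slice P θ s)
  rw [hf] at h1
  rw [section_eq P θ s h, dim_eq, hiso.hausdorffMeasure_image (Or.inl (by positivity)), h1,
    pL_normDet θ h, hc_spec]
  have h2 : volume (WithLp.toLp 2 '' slice P θ s) = volume (slice P θ s) := by
    have mp := PiLp.volume_preserving_toLp (Fin (k+1))
    have := mp.measure_preimage_emb (MeasurableEquiv.toLp 2 _).measurableEmbedding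
      (WithLp.toLp 2 '' slice P θ s)
    rw [preimage_image_eq _ (WithLp.toLp_injective 2)] at this
    exact this.symm
  rw [Measure.smul_apply, h2, ENNReal.toReal_mul, ENNReal.toReal_ofReal (by positivity)]
  simp [NNReal.smul_def, ENNReal.smul_def]
  ring


lemma slice_smul {k : ℕ} (P : Set (Euc (k+2))) (θ : Euc (k+2)) (s l : ℝ) (hl : 0 < l) :
    slice P (l • θ) (l * s) = slice P θ s := by
  ext u
  have : (l * s - ∑ i : Fin (k+1), (l • θ) i.castSucc * u i) / (l • θ) (Fin.last (k+1))
      = (s - ∑ i : Fin (k+1), θ i.castSucc * u i) / θ (Fin.last (k+1)) := by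
    simp only [PiLp.smul_apply, smul_eq_mul, mul_assoc]
    rw [← Finset.mul_sum, ← mul_sub, mul_div_mul_left _ _ hl.ne']
  show pt u _ ∈ P ↔ pt u _ ∈ P
  rw [this]

lemma Fv_smul {k : ℕ} (c : ℝ) (P : Set (Euc (k+2))) (θ : Euc (k+2)) (s l : ℝ) (hl : 0 < l) :
    Fv c P (l • θ) (l * s) = Fv c P θ s := by
  unfold Fv Sl
  rw [slice_smul P θ s l hl, norm_smul, PiLp.smul_apply, smul_eq_mul, abs_mul, Real.norm_eq_abs,
    mul_div_mul_left _ _ (abs_ne_zero.2 hl.ne')]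

def psi {k : ℕ} (y : Fin (k+1) → ℝ) : Euc (k+2) := ‖pt y 1‖⁻¹ • pt y 1

lemma pt_ge {k : ℕ} (y : Fin (k+1) → ℝ) : 1 ≤ ‖pt y 1‖ := by
  have := PiLp.norm_apply_le (pt y 1) (Fin.last (k+1))
  rw [pt_last] at this
  simpa using this

lemma norm_lip {E : Type*} [NormedAddCommGroup E] [NormedSpace ℝ E] (x y : E) (hx : 1 ≤ ‖x‖) (hy : 1 ≤ ‖y‖) :
    ‖‖x‖⁻¹ • x - ‖y‖⁻¹ • y‖ ≤ 2 * ‖x - y‖ := by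
  have hx0 : 0 < ‖x‖ := by linarith
  have hy0 : 0 < ‖y‖ := by linarith
  have e : ‖x‖⁻¹ • x - ‖y‖⁻¹ • y = ‖x‖⁻¹ • (x - y) + (‖x‖⁻¹ - ‖y‖⁻¹) • y := by
    rw [smul_sub, sub_smul]; abel
  have h1 : ‖‖x‖⁻¹ • (x - y)‖ ≤ ‖x - y‖ := by
    rw [norm_smul, norm_inv, norm_norm]
    exact mul_le_of_le_one_left (norm_nonneg _) (inv_le_one_of_one_le₀ hx)
  have h2 : ‖(‖x‖⁻¹ - ‖y‖⁻¹) • y‖ ≤ ‖x - y‖ := by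
    have : (‖x‖⁻¹ - ‖y‖⁻¹) = ‖x‖⁻¹ * (‖y‖ - ‖x‖) * ‖y‖⁻¹ := by field_simp
    rw [norm_smul, this, norm_mul, norm_mul, norm_inv, norm_inv, norm_norm, norm_norm, mul_assoc,
      inv_mul_cancel₀ hy0.ne', mul_one]
    have h3 : ‖‖y‖ - ‖x‖‖ ≤ ‖x - y‖ := by
      rw [norm_sub_rev x y]; exact abs_norm_sub_norm_le y x
    exact (mul_le_of_le_one_left (norm_nonneg _) (inv_le_one_of_one_le₀ hx)).trans h3
  rw [e]
  refine (norm_add_le _ _).trans (by linarith)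

lemma psi_lip {k : ℕ} : ∃ K : ℝ≥0, LipschitzWith K (psi (k := k)) := by
  refine ⟨2 * (k+1), LipschitzWith.of_dist_le_mul fun u v => ?_⟩
  rw [dist_eq_norm, dist_eq_norm]
  refine (norm_lip _ _ (pt_ge u) (pt_ge v)).trans ?_
  push_cast
  rw [mul_assoc]
  refine mul_le_mul_of_nonneg_left ?_ (by norm_num)
  refine (pow_le_pow_iff_left₀ (norm_nonneg _) (by positivity) two_ne_zero).1 ?_
  rw [norm_split]
  simp only [PiLp.sub_apply, pt_cast, pt_last]
  have : ∀ i ∈ (Finset.univ : Finset (Fin (k+1))), (u i - v i) ^ 2 ≤ ‖u - v‖ ^ 2 := by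
    intro i _
    rw [← sq_abs (u i - v i)]
    exact pow_le_pow_left₀ (abs_nonneg _) (norm_le_pi_norm (u - v) i) 2
  have h2 := Finset.sum_le_sum this
  simp at h2
  have h3 : (0:ℝ) ≤ k := Nat.cast_nonneg k
  have h4 : 0 ≤ ‖u - v‖ ^ 2 := by positivity
  nlinarith [mul_nonneg h3 h4, mul_nonneg (mul_nonneg h3 h3) h4]

lemma equator_null {k : ℕ} :
    (μH[((k+1 : ℕ) : ℝ)] : Measure (Euc (k+2))) {θ | ‖θ‖ = 1 ∧ θ (Fin.last (k+1)) = 0} = 0 := by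
  have hiso : Isometry (fun u : Euc (k+1) => pt u.ofLp 0) := by
    refine Isometry.of_dist_eq fun u v => ?_
    rw [dist_eq_norm, dist_eq_norm]
    refine (pow_left_inj₀ (norm_nonneg _) (norm_nonneg _) two_ne_zero).1 ?_
    rw [norm_split, EuclideanSpace.norm_sq_eq]
    simp [pt_cast, pt_last]
  have h0 : (μH[((k+1 : ℕ) : ℝ)] : Measure (Euc (k+1))) (Metric.sphere 0 1) = 0 :=
    Measure.addHaar_sphere_of_ne_zero _ _ one_ne_zero
  rw [← hiso.hausdorffMeasure_image (Or.inl (by positivity))] at h0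
  refine measure_mono_null ?_ h0
  rintro θ ⟨h1, h2⟩
  refine ⟨WithLp.toLp 2 (fun i => θ i.castSucc), ?_, ?_⟩
  · rw [mem_sphere_zero_iff_norm]
    refine (pow_left_inj₀ (norm_nonneg _) (by norm_num) two_ne_zero).1 ?_
    rw [← h1, norm_split, EuclideanSpace.norm_sq_eq, h2]
    simp
  · apply euc_ext
    · intro i; simp [pt_cast]
    · simp [pt_last, h2]

lemma hemi_measurable {n : ℕ} : MeasurableSet (upperHemi n) := by
  unfold upperHemi
  have h1 : MeasurableSet {θ : Euc n | ‖θ‖ = 1} := measurableSet_eq_fun (by fun_prop) measurable_const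
  have h2 : MeasurableSet {θ : Euc n | ∀ i : Fin n, (i : ℕ) = n - 1 → 0 ≤ θ i} := by
    rw [show {θ : Euc n | ∀ i : Fin n, (i : ℕ) = n - 1 → 0 ≤ θ i}
      = ⋂ i : Fin n, {θ : Euc n | (i : ℕ) = n - 1 → 0 ≤ θ i} by ext; simp]
    refine MeasurableSet.iInter fun i => ?_
    by_cases h : (i : ℕ) = n - 1
    · simp only [h, forall_const]
      exact measurableSet_le measurable_const (by fun_prop)
    · simp [h]
  exact h1.inter h2

lemma sph_null {k : ℕ} {c : ℝ} (hc : 0 < c) (V : Finset (Euc (k+2)))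
    {N : Set ℝ} (hNm : MeasurableSet N) (hN : volume N = 0) :
    ∀ᵐ θ ∂(sphMeasure (k+2)).restrict (upperHemi (k+2)), 0 < θ (Fin.last (k+1)) ∧ 
    volume {s : ℝ | 0 < Fv c (convexHull ℝ (V : Set (Euc (k+2)))) θ s ∧
      Fv c (convexHull ℝ (V : Set (Euc (k+2)))) θ s ∈ N} = 0 := by
  generalize hP : convexHull ℝ (V : Set (Euc (k+2))) = P
  have hy := y_null hc V hNm hN
  rw [hP] at hy
  set B : Set (Fin (k+1) → ℝ) :=
    {y | ¬ volume {s : ℝ | 0 < Fv c P (pt y 1) s ∧ Fv c P (pt y 1) s ∈ N} = 0} with hB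
  have hB0 : volume B = 0 := hy
  obtain ⟨K, hK⟩ := psi_lip (k := k)
  have hB1 : (μH[((k+1 : ℕ) : ℝ)] : Measure (Euc (k+2))) (psi '' B) = 0 := by
    have h := hK.hausdorffMeasure_image_le (d := ((k+1 : ℕ) : ℝ)) (by positivity) B
    have h2 := hausdorffMeasure_pi_real (ι := Fin (k+1))
    rw [Fintype.card_fin] at h2
    rw [h2, hB0, mul_zero] at h
    exact le_antisymm h zero_le
  rw [ae_restrict_iff' hemi_measurable, sphMeasure, dim_eq]
  refine measure_mono_null ?_ (measure_union_null equator_null hB1)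
  intro θ hθ
  have hθ : ¬ (θ ∈ upperHemi (k+2) → _) := hθ
  rw [Classical.not_imp] at hθ
  obtain ⟨⟨h1, h2⟩, h3⟩ := hθ
  have h2 := h2 (Fin.last (k+1)) (by simp)
  rcases h2.eq_or_lt with h2 | h2
  · exact Or.inl ⟨h1, h2.symm⟩
  right
  replace h3 : ¬ volume {s : ℝ | 0 < Fv c P θ s ∧ Fv c P θ s ∈ N} = 0 := fun h => h3 ⟨h2, h⟩
  set a := θ (Fin.last (k+1)) with ha
  have e : pt (fun i => θ i.castSucc / a) 1 = a⁻¹ • θ := by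
    apply euc_ext
    · intro i; simp [pt_cast, div_eq_inv_mul]
    · simp [pt_last, ← ha, h2.ne']
  refine ⟨fun i => θ i.castSucc / a, ?_, ?_⟩
  · intro h
    rw [e] at h
    apply h3
    have : {s : ℝ | 0 < Fv c P θ s ∧ Fv c P θ s ∈ N} =
      a • {s : ℝ | 0 < Fv c P (a⁻¹ • θ) s ∧ Fv c P (a⁻¹ • θ) s ∈ N} := by
      ext s
      rw [mem_smul_set_iff_inv_smul_mem₀ h2.ne']
      show _ ↔ 0 < Fv c P (a⁻¹ • θ) (a⁻¹ * s) ∧ Fv c P (a⁻¹ • θ) (a⁻¹ * s) ∈ N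
      rw [Fv_smul c P θ s _ (inv_pos.2 h2)]
      rfl
    rw [this, Measure.addHaar_smul, h, mul_zero]
  · rw [psi, e, norm_smul, h1, norm_inv, Real.norm_eq_abs, abs_of_pos h2, smul_smul]
    simp [h2.ne']

lemma pos_ae {k : ℕ} {c : ℝ} (hc : 0 < c) {P : Set (Euc (k+2))} (hconv : Convex ℝ P)
    (hbd : Bornology.IsBounded P) (hint : (interior P).Nonempty) (θ : Euc (k+2))
    (h : θ (Fin.last (k+1)) ≠ 0) :
    ∀ᵐ s : ℝ, ((P ∩ hyperplane θ s).Nonempty ↔ 0 < Fv c P θ s) := by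
  set f : Euc (k+2) → ℝ := fun x => ⟪x, θ⟫ with hf
  have hfc : Continuous f := by fun_prop
  have hIc : Convex ℝ (f '' interior P) := by
    have : f = ((innerₗ (Euc (k+2))).flip θ) := by ext; simp [hf, real_inner_comm]
    rw [this]
    exact hconv.interior.linear_image _
  have hfr := hIc.addHaar_frontier volume
  have hθ0 : 0 < ‖θ‖ := norm_pos_iff.2 (by rintro rfl; simp at h)
  have : ∀ᵐ s : ℝ, s ∉ frontier (f '' interior P) := by
    rw [ae_iff]; simpa using hfr
  filter_upwards [this] with s hs
  constructor
  · rintro ⟨x, hx, hxs⟩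
    have hxs : f x = s := hxs
    have h1 : x ∈ closure (interior P) := by
      rw [hconv.closure_interior_eq_closure_of_nonempty_interior hint]
      exact subset_closure hx
    have h2 : s ∈ closure (f '' interior P) := hxs ▸ image_closure_subset_closure_image hfc ⟨x, h1, rfl⟩
    have h3 : s ∈ interior (f '' interior P) := by
      by_contra h4; exact hs ⟨h2, h4⟩
    have h5 : (interior P ∩ hyperplane θ s).Nonempty := by
      obtain ⟨z, hz, hzs⟩ := interior_subset h3
      exact ⟨z, hz, hzs⟩
    rw [section_eq _ _ _ h, image_nonempty, image_nonempty, image_nonempty] at h5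
    have hop : IsOpen (slice (interior P) θ s) := by
      have : Continuous fun u : Fin (k+1) → ℝ => 
          pt u ((s - ∑ i : Fin (k+1), θ i.castSucc * u i) / θ (Fin.last (k+1))) := by
        unfold pt
        refine (PiLp.continuous_toLp 2 _).comp ?_
        refine Continuous.finSnoc continuous_id ?_
        fun_prop
      exact isOpen_interior.preimage this
    have hpos := hop.measure_pos volume h5
    have hsub : slice (interior P) θ s ⊆ slice P θ s := fun u hu => interior_subset (s := P) hu
    have h6 : 0 < Sl P θ s :=
      ENNReal.toReal_pos (hpos.trans_le (measure_mono hsub)).ne' (slice_finite hbd θ s).ne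
    have : 0 < |θ (Fin.last (k+1))| := abs_pos.2 h
    unfold Fv
    positivity
  · intro hF
    rw [section_eq _ _ _ h, image_nonempty, image_nonempty, image_nonempty]
    by_contra h0
    rw [not_nonempty_iff_eq_empty] at h0
    simp [Fv, Sl, h0] at hF


lemma int_ind {Q R : Set ℝ} (hR : MeasurableSet R) (h : ∀ᵐ s, (s ∈ Q ↔ s ∈ R)) :
    ∫ s : ℝ, Set.indicator Q (fun _ => (1 : ℝ)) s = (volume R).toReal := by
  have : ∫ s : ℝ, Set.indicator Q (fun _ => (1 : ℝ)) s = ∫ s : ℝ, Set.indicator R (fun _ => (1 : ℝ)) s := by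
    apply integral_congr_ae
    filter_upwards [h] with s hs
    by_cases hq : s ∈ Q
    · simp [hq, hs.1 hq]
    · have : s ∉ R := fun hr => hq (hs.2 hr)
      simp [hq, this]
  rw [this, integral_indicator hR]
  simp [Measure.real]

lemma Fv_support_finite {k : ℕ} {c : ℝ} {P : Set (Euc (k+2))} (hbd : Bornology.IsBounded P)
    (θ : Euc (k+2)) (h : θ (Fin.last (k+1)) ≠ 0) : volume {s : ℝ | 0 < Fv c P θ s} < ∞ := by
  obtain ⟨r, hr0, hr⟩ := hbd.exists_pos_norm_lt
  refine (measure_mono (t := Icc (-(r * ‖θ‖)) (r * ‖θ‖)) ?_).trans_lt (by simp)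
  intro s hs
  have hs : 0 < Fv c P θ s := hs
  have : (P ∩ hyperplane θ s).Nonempty := by
    rw [section_eq _ _ _ h, image_nonempty, image_nonempty, image_nonempty]
    by_contra h0
    rw [not_nonempty_iff_eq_empty] at h0
    simp [Fv, Sl, h0] at hs
  obtain ⟨x, hx, hxs⟩ := this
  have hxs : ⟪x, θ⟫ = s := hxs
  have h1 := abs_real_inner_le_norm x θ
  rw [hxs] at h1
  have h2 : ‖x‖ * ‖θ‖ ≤ r * ‖θ‖ := mul_le_mul_of_nonneg_right (hr x hx).le (norm_nonneg _)
  exact abs_le.1 (h1.trans h2)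

lemma assemble {X : Type*} [MeasurableSpace X] (ν : Measure X) (F : X × ℝ → ℝ) (hF : Measurable F)
    (hfin : ∀ᵐ θ ∂ν, volume {s : ℝ | 0 < F (θ, s)} < ∞)
    (hnull : ∀ N : Set ℝ, MeasurableSet N → volume N = 0 →
      ∀ᵐ θ ∂ν, volume {s : ℝ | 0 < F (θ, s) ∧ F (θ, s) ∈ N} = 0) :
    IsAbsolutelyContinuousCDF fun z => (1 / ∫ θ, (volume {s : ℝ | 0 < F (θ, s)}).toReal ∂ν) *
      ∫ θ, (volume {s : ℝ | 0 < F (θ, s) ∧ F (θ, s) ∈ Iic z}).toReal ∂ν := by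
  set m := ∫ θ, (volume {s : ℝ | 0 < F (θ, s)}).toReal ∂ν with hm
  by_cases hm0 : m = 0
  · exact ⟨fun _ => 0, fun _ => le_rfl, fun z => by simp [hm0]⟩
  have hmn : 0 ≤ m := integral_nonneg fun _ => ENNReal.toReal_nonneg
  have hint : Integrable (fun θ => (volume {s : ℝ | 0 < F (θ, s)}).toReal) ν := by
    by_contra h
    exact hm0 (integral_undef h)
  have hT : MeasurableSet {p | 0 < F p} := measurableSet_lt measurable_const hF
  set D : Measure ℝ := ((ν.prod volume).restrict {p | 0 < F p}).map F with hD
  have hDa : ∀ N, MeasurableSet N → D N = ∫⁻ θ, volume {s : ℝ | 0 < F (θ, s) ∧ F (θ, s) ∈ N} ∂ν := by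
    intro N hN
    rw [hD, Measure.map_apply hF hN, Measure.restrict_apply (hF hN),
      Measure.prod_apply ((hF hN).inter hT)]
    congr 1
    funext θ
    congr 1
    ext s
    exact and_comm
  have hmeas : ∀ N, MeasurableSet N → Measurable fun θ =>
      volume {s : ℝ | 0 < F (θ, s) ∧ F (θ, s) ∈ N} := by
    intro N hN
    have := measurable_measure_prodMk_left (ν := (volume : Measure ℝ)) (hT.inter (hF hN))
    exact this
  have hDfin : IsFiniteMeasure D := by
    constructor
    rw [hDa _ MeasurableSet.univ]
    have := hint.lintegral_lt_top
    refine lt_of_eq_of_lt (lintegral_congr_ae ?_) this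
    filter_upwards [hfin] with θ hθ
    rw [ENNReal.ofReal_toReal hθ.ne]
    simp
  have hac : D ≪ volume := by
    refine Measure.AbsolutelyContinuous.mk fun N hN h0 => ?_
    rw [hDa N hN]
    exact lintegral_eq_zero_of_ae_eq_zero (hnull N hN h0)
  refine ⟨fun t => (1 / m) * (D.rnDeriv volume t).toReal, fun t => by positivity, fun z => ?_⟩
  rw [integral_const_mul, Measure.setIntegral_toReal_rnDeriv hac]
  show (1 / m) * _ = (1 / m) * _
  congr 1
  rw [Measure.real, hDa _ measurableSet_Iic]
  refine integral_toReal (hmeas _ measurableSet_Iic).aemeasurable ?_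
  filter_upwards [hfin] with θ hθ
  exact (measure_mono fun s hs => hs.1).trans_lt hθ

lemma main_aux {k : ℕ} (P : Set (Euc (k+2))) (hP : IsFullDimPolytope P) :
    IsAbsolutelyContinuousCDF (sectionCDF P) := by
  obtain ⟨⟨V, hV⟩, hint⟩ := hP
  have hPc : IsCompact P := by rw [hV]; exact V.finite_toSet.isCompact_convexHull ℝ
  have hPm : MeasurableSet P := hPc.isClosed.measurableSet
  have hconv : Convex ℝ P := by rw [hV]; exact convex_convexHull ℝ _
  have hbd := hPc.isBounded
  have hc0 : (0:ℝ) < hc k := by exact_mod_cast pos_iff_ne_zero.2 (hc_ne k)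
  have hnull : ∀ N : Set ℝ, MeasurableSet N → volume N = 0 →
      ∀ᵐ θ ∂(sphMeasure (k+2)).restrict (upperHemi (k+2)), 0 < θ (Fin.last (k+1)) ∧
        volume {s : ℝ | 0 < Fv (hc k) P θ s ∧ Fv (hc k) P θ s ∈ N} = 0 := by
    intro N hN h0
    have := sph_null hc0 V hN h0
    rwa [← hV] at this
  have hpos : ∀ᵐ θ ∂(sphMeasure (k+2)).restrict (upperHemi (k+2)), 0 < θ (Fin.last (k+1)) := by
    filter_upwards [hnull ∅ MeasurableSet.empty measure_empty] with θ hθ using hθ.1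
  have hFm := Fv_measurable (hc k : ℝ) hPm
  have hFs : ∀ θ : Euc (k+2), Measurable fun s => Fv (hc k) P θ s := by
    intro θ
    have := Measurable.comp hFm (measurable_prodMk_left (x := θ))
    simpa only [Function.comp_def] using this
  have key := assemble ((sphMeasure (k+2)).restrict (upperHemi (k+2))) _ hFm
    (by filter_upwards [hpos] with θ hθ using Fv_support_finite hbd θ hθ.ne')
    (fun N hN h0 => by filter_upwards [hnull N hN h0] with θ hθ using hθ.2)
  convert key using 1
  funext z
  unfold sectionCDF muBracket
  congr 1
  · congr 1
    refine integral_congr_ae ?_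
    filter_upwards [hpos] with θ hθ
    exact int_ind (measurableSet_lt measurable_const (hFs θ)) (pos_ae hc0 hconv hbd hint θ hθ.ne')
  · refine integral_congr_ae ?_
    filter_upwards [hpos] with θ hθ
    refine int_ind ((measurableSet_lt measurable_const (hFs θ)).inter ((hFs θ) measurableSet_Iic)) ?_
    filter_upwards [pos_ae hc0 hconv hbd hint θ hθ.ne'] with s hs
    show (sectionVolume P θ s ≤ z ∧ (P ∩ hyperplane θ s).Nonempty) ↔ (0 < Fv (hc k) P θ s ∧ Fv (hc k) P θ s ≤ z)
    rw [section_measure hPm θ s hθ.ne', hs, and_comm]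

/-- the section volume CDF of a full-dimensional convex polytope is
absolutely continuous with respect to Lebesgue measure. -/
theorem sectionCDF_absolutelyContinuous_of_polytope {n : ℕ} (hn : 2 ≤ n)
    (P : Set (Euc n)) (hP : IsFullDimPolytope P) :
    IsAbsolutelyContinuousCDF (sectionCDF P) := by
  obtain ⟨k, rfl⟩ : ∃ k, n = k + 2 := ⟨n - 2, by omega⟩
  exact main_aux P hP
end
end
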